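/- Let d ≥ 2 be an integer, k = d+1, and let ω ∈ 𝒢_{k,3}. With the convention log x := max{1, log x}, there exist α ∈ ℝ^d and a constant C > 0 such that for every integer N ≥ 1 and every test box 𝔅 = (γ;ρ), one has |D_ω(𝔅;N)| ≤ C·(log N)^{d−1}·log log N. -/

import Mathlib

open scoped BigOperators

/-- The Fourier transform `∫ w(x) e^{-2πiξx} dx` of a real weight function. -/
noncomputable def fhat (w : ℝ → ℝ) (ξ : ℝ) : ℂ :=
  ∫ x : ℝ, (w x : ℂ) * Complex.exp (-(2 * Real.pi * Complex.I * ξ * x))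

/-- The class 𝒢_{k,ℓ} of good weight tuples. -/
def GoodWeights (k ℓ : ℕ) (w : Fin k → ℝ → ℝ) : Prop :=
  ∀ i : Fin k,
    (∀ x, 0 ≤ w i x) ∧
    (Function.support (w i) ⊆ Set.Icc (-2 : ℝ) 2) ∧
    ContDiff ℝ ℓ (w i) ∧
    (∀ ξ : ℝ, (fhat (w i) ξ).im = 0 ∧ 0 ≤ (fhat (w i) ξ).re) ∧
    0 < (fhat (w i) 0).re

/-- Multiplicative height `H(m) = ∏ max(1,|mᵢ|)`. -/
noncomputable def Hmul {d : ℕ} (m : Fin d → ℝ) : ℝ := ∏ i, max 1 |m i|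

/-- Distance from `x` to the nearest integer. -/
noncomputable def distInt (x : ℝ) : ℝ := |x - (round x : ℝ)|

/-- The constant 𝔠(ω) = ω̂₁(0)⋯ω̂_k(0). -/
noncomputable def smoothC {k : ℕ} (w : Fin k → ℝ → ℝ) : ℝ := ∏ i, (fhat (w i) 0).re

/-- Smooth discrepancy of the Kronecker sequence of α in the box (γ; ρ) at scale N. -/
noncomputable def Dbox (d : ℕ) (w : Fin (d+1) → ℝ → ℝ) (α γ ρ : Fin d → ℝ) (N : ℝ) : ℝ :=
  (∑' p : (Fin d → ℤ) × ℤ,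
      w (Fin.last d) ((p.2 : ℝ) / N) *
        ∏ i : Fin d, w i.castSucc (((p.1 i : ℝ) + (p.2 : ℝ) * α i - γ i) / ρ i))
    - smoothC w * ((∏ i, ρ i) * N)

/-- The point of the lattice `A ℤ^k` indexed by the integer vector `a`. -/
noncomputable def latPt {k : ℕ} (A : Matrix (Fin k) (Fin k) ℝ) (a : Fin k → ℤ) : Fin k → ℝ :=
  A.mulVec (fun i => (a i : ℝ))

/-- The point of the dual lattice `(A⁻¹)ᵀ ℤ^k` indexed by the integer vector `a`. -/
noncomputable def dualPt {k : ℕ} (A : Matrix (Fin k) (Fin k) ℝ) (a : Fin k → ℤ) : Fin k → ℝ :=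
  (A⁻¹).transpose.mulVec (fun i => (a i : ℝ))

/-- Smooth lattice discrepancy of the lattice `A ℤ^{d+1}` in the box (γ; ρ) at scale N. -/
noncomputable def DboxLat (d : ℕ) (A : Matrix (Fin (d+1)) (Fin (d+1)) ℝ)
    (w : Fin (d+1) → ℝ → ℝ) (γ ρ : Fin d → ℝ) (N : ℝ) : ℝ :=
  (∑' a : Fin (d+1) → ℤ,
      w (Fin.last d) (latPt A a (Fin.last d) / N) *
        ∏ i : Fin d, w i.castSucc ((latPt A a i.castSucc - γ i) / ρ i))
    - smoothC w * ((∏ i, ρ i) * N)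

/-- Side-length vector of a test box: each ρᵢ ∈ (0, 1/2). -/
def IsBox {d : ℕ} (ρ : Fin d → ℝ) : Prop := ∀ i, 0 < ρ i ∧ ρ i < 1/2

/-- Every nonzero dual lattice point (λ, λ_k) satisfies H(λ)·|λ_k| > 1/φ(H(λ)). -/
def DualBad (d : ℕ) (A : Matrix (Fin (d+1)) (Fin (d+1)) ℝ) (φ : ℝ → ℝ) : Prop :=
  ∀ a : Fin (d+1) → ℤ, dualPt A a ≠ 0 →
    Hmul (fun i : Fin d => dualPt A a i.castSucc) * |dualPt A a (Fin.last d)| >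
      1 / φ (Hmul (fun i : Fin d => dualPt A a i.castSucc))

lemma sum_inv_nat (y : ℝ) (hy : 1 ≤ y) (n : ℕ) :
    ∑ c ∈ Finset.range n, 1 / (1 + ((c + 1 : ℝ) / y) ^ 2) ≤ 2 * y ^ 2 * (1 / y - 1 / (y + n)) := by
  have hy0 : 0 < y := by linarith
  induction n with
  | zero => simp
  | succ n ih =>
    rw [Finset.sum_range_succ]
    have h : 1 / (1 + ((n + 1 : ℝ) / y) ^ 2) ≤ 2 * y ^ 2 * (1 / (y + n) - 1 / (y + n + 1)) := by
      have hn : (0 : ℝ) ≤ n := Nat.cast_nonneg n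
      have e1 : 2 * y ^ 2 * (1 / (y + n) - 1 / (y + n + 1)) = 2 * y ^ 2 / ((y + n) * (y + n + 1)) := by
        field_simp; ring
      have e2 : 1 / (1 + ((n + 1 : ℝ) / y) ^ 2) = y ^ 2 / (y ^ 2 + (n + 1) ^ 2) := by
        field_simp
      rw [e1, e2, div_le_div_iff₀ (by positivity) (by positivity)]
      have : (y + n) * (y + n + 1) ≤ 2 * (y ^ 2 + (n + 1) ^ 2) := by
        nlinarith [sq_nonneg (y - (n + 1))]
      nlinarith [mul_le_mul_of_nonneg_left this (sq_nonneg y)]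
    push_cast
    rw [← add_assoc]
    linarith

lemma sum_inv (y : ℝ) (hy : 1 ≤ y) (F : Finset ℤ) :
    ∑ c ∈ F, 1 / (1 + ((c : ℝ) / y) ^ 2) ≤ 5 * y := by
  have hy0 : 0 < y := by linarith
  set g : ℤ → ℝ := fun c => 1 / (1 + ((c : ℝ) / y) ^ 2) with hg
  have g0 : ∀ c, 0 ≤ g c := fun c => by simp only [hg]; positivity
  obtain ⟨n, hn⟩ : ∃ n : ℕ, ∀ c ∈ F, c.natAbs ≤ n :=
    ⟨F.sup Int.natAbs, fun c hc => Finset.le_sup (f := Int.natAbs) hc⟩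
  have hsub : F ⊆ insert 0 (((Finset.range n).image (fun k : ℕ => (k : ℤ) + 1)) ∪
      ((Finset.range n).image (fun k : ℕ => -((k : ℤ) + 1)))) := by
    intro c hc
    have := hn c hc
    simp only [Finset.mem_insert, Finset.mem_union, Finset.mem_image, Finset.mem_range]
    rcases lt_trichotomy c 0 with h | h | h
    · right; right; exact ⟨c.natAbs - 1, by omega, by omega⟩
    · left; exact h
    · right; left; exact ⟨c.natAbs - 1, by omega, by omega⟩
  have hs : ∑ c ∈ Finset.range n, 1 / (1 + ((c + 1 : ℝ) / y) ^ 2) ≤ 2 * y := by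
    refine (sum_inv_nat y hy n).trans ?_
    have : 0 ≤ 1 / (y + n) := by positivity
    have e : 2 * y ^ 2 * (1 / y - 1 / (y + n)) = 2 * y - 2 * y ^ 2 * (1 / (y + n)) := by
      field_simp
    rw [e]
    nlinarith [mul_nonneg (sq_nonneg y) this]
  calc ∑ c ∈ F, g c ≤ ∑ c ∈ _, g c := Finset.sum_le_sum_of_subset_of_nonneg hsub (fun c _ _ => g0 c)
    _ ≤ g 0 + ∑ c ∈ _, g c := by
      by_cases h0 : (0 : ℤ) ∈ (((Finset.range n).image (fun k : ℕ => (k : ℤ) + 1)) ∪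
      ((Finset.range n).image (fun k : ℕ => -((k : ℤ) + 1))))
      · rw [Finset.insert_eq_of_mem h0]; linarith [g0 0]
      · rw [Finset.sum_insert h0]
    _ ≤ g 0 + (∑ c ∈ (Finset.range n).image (fun k : ℕ => (k : ℤ) + 1), g c +
        ∑ c ∈ (Finset.range n).image (fun k : ℕ => -((k : ℤ) + 1)), g c) := by
      gcongr
      rw [← Finset.sum_union_inter]
      have := Finset.sum_nonneg (s := ((Finset.range n).image (fun k : ℕ => (k : ℤ) + 1)) ∩
        ((Finset.range n).image (fun k : ℕ => -((k : ℤ) + 1)))) (fun c _ => g0 c)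
      linarith
    _ ≤ 1 + (2 * y + 2 * y) := by
      gcongr
      · simp [hg]
      · rw [Finset.sum_image (by intro a _ b _ h; simpa using h)]
        refine le_trans (le_of_eq ?_) hs
        apply Finset.sum_congr rfl; intro c _; simp [hg]
      · rw [Finset.sum_image (by intro a _ b _ h; simpa using h)]
        refine le_trans (le_of_eq ?_) hs
        apply Finset.sum_congr rfl; intro c _
        simp only [hg]
        congr 2
        push_cast
        rw [← sq_abs, ← sq_abs ((c + 1 : ℝ) / y)]
        rw [neg_div, abs_neg]
    _ ≤ 5 * y := by linarith

lemma cell_sum {κ ι : Type*} [Fintype κ] [DecidableEq κ] (F : Finset ι) (f : ι → κ → ℤ)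
    (hf : Set.InjOn f F) (y : κ → ℝ) (hy : ∀ i, 1 ≤ y i) :
    ∑ x ∈ F, ∏ i, 1 / (1 + ((f x i : ℝ) / y i) ^ 2) ≤ ∏ i, (5 * y i) := by
  classical
  have h1 : ∑ x ∈ F, ∏ i, 1 / (1 + ((f x i : ℝ) / y i) ^ 2)
      = ∑ c ∈ F.image f, ∏ i, 1 / (1 + ((c i : ℝ) / y i) ^ 2) := by
    rw [Finset.sum_image hf]
  rw [h1]
  set B : κ → Finset ℤ := fun i => (F.image f).image (fun c => c i)
  calc _ ≤ ∑ c ∈ Fintype.piFinset B, ∏ i, 1 / (1 + ((c i : ℝ) / y i) ^ 2) := by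
        apply Finset.sum_le_sum_of_subset_of_nonneg
        · intro c hc
          rw [Fintype.mem_piFinset]
          intro i
          exact Finset.mem_image_of_mem _ hc
        · intros; positivity
    _ = ∏ i, ∑ c ∈ B i, 1 / (1 + ((c : ℝ) / y i) ^ 2) := by
        rw [Finset.prod_univ_sum]
    _ ≤ _ := by
        apply Finset.prod_le_prod
        · intros; positivity
        · intro i _; exact sum_inv (y i) (hy i) _

lemma exists_shrink {d : ℕ} (M : Fin d → ℝ) (hM : ∀ i, 1 ≤ M i) (X : ℝ) (hX : 1 ≤ X)
    (hXM : X ≤ ∏ i, M i) :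
    ∃ P : Fin d → ℝ, (∀ i, 1 ≤ P i) ∧ (∀ i, P i ≤ M i) ∧ ∏ i, P i = X := by
  set T := ∏ i, M i with hT
  have hT1 : 1 ≤ T := hX.trans hXM
  rcases eq_or_lt_of_le hT1 with h | h
  · refine ⟨M, hM, fun i => le_rfl, ?_⟩
    rw [← hT]; linarith
  set θ := Real.log X / Real.log T with hθ
  have hlT : 0 < Real.log T := Real.log_pos h
  have hθ0 : 0 ≤ θ := div_nonneg (Real.log_nonneg hX) hlT.le
  have hθ1 : θ ≤ 1 := by
    rw [hθ, div_le_one hlT]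
    exact Real.log_le_log (by linarith) hXM
  refine ⟨fun i => M i ^ θ, fun i => Real.one_le_rpow (hM i) hθ0, fun i => ?_, ?_⟩
  · calc M i ^ θ ≤ M i ^ (1 : ℝ) := Real.rpow_le_rpow_of_exponent_le (hM i) hθ1
      _ = M i := Real.rpow_one _
  · rw [Real.finsetProd_rpow _ _ (fun i _ => by linarith [hM i]), ← hT,
      Real.rpow_def_of_pos (by linarith), hθ, mul_div_cancel₀ _ hlT.ne', Real.exp_log (by linarith)]

lemma weight_cell (x y c : ℝ) (hy : 1 ≤ y) (hc : |c| ≤ y * |x| + 1) :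
    ((1 + |x|)⁻¹) ^ 2 ≤ 4 * (1 / (1 + (c / y) ^ 2)) := by
  have hy0 : 0 < y := by linarith
  have hx := abs_nonneg x
  have h1 : |c / y| ≤ |x| + 1 := by
    rw [abs_div, abs_of_pos hy0, div_le_iff₀ hy0]
    nlinarith
  have h2 : (c / y) ^ 2 ≤ (|x| + 1) ^ 2 := by
    rw [← sq_abs]
    exact pow_le_pow_left₀ (abs_nonneg _) h1 2
  rw [inv_pow, mul_one_div, inv_eq_one_div, div_le_div_iff₀ (by positivity) (by positivity)]
  nlinarith

lemma lattice_sum_cells (d : ℕ) (α : Fin d → ℝ) (N : ℝ) (hN : 1 ≤ N) (Tp : ℝ)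
    (hTpN : Tp ≤ N)
    (hbad : ∀ m : Fin d → ℤ, m ≠ 0 → ∏ i, max 1 |(m i : ℝ)| ≤ N → ∀ n : ℤ,
      Tp / (N * ∏ i, max 1 |(m i : ℝ)|) ≤ |(n : ℝ) - ∑ i, (m i : ℝ) * α i|)
    (M P : Fin d → ℝ) (hP : ∀ i, 1 ≤ P i) (hPM : ∀ i, P i ≤ M i)
    (hPT : ∏ i, P i ≤ max 1 Tp) (F : Finset ((Fin d → ℤ) × ℤ)) :
    ∑ p ∈ F, (∏ i, ((1 + |(p.1 i : ℝ) / M i|)⁻¹) ^ 2) *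
      ((1 + |N * ((p.2 : ℝ) - ∑ i, (p.1 i : ℝ) * α i)|)⁻¹) ^ 2 ≤
      20 ^ (d + 1) * ((∏ i, M i) / ∏ i, P i) := by
  classical
  have hN0 : 0 < N := by linarith
  have hP0 : ∀ i, 0 < P i := fun i => by linarith [hP i]
  have hM0 : ∀ i, 0 < M i := fun i => by linarith [hP i, hPM i]
  let f : ((Fin d → ℤ) × ℤ) → Option (Fin d) → ℤ := fun p o =>
    Option.elim o ⌊N * ((p.2 : ℝ) - ∑ i, (p.1 i : ℝ) * α i)⌋ (fun i => ⌊(p.1 i : ℝ) / P i⌋)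
  let y : Option (Fin d) → ℝ := fun o => Option.elim o 1 (fun i => M i / P i)
  have hy : ∀ o, 1 ≤ y o := by
    intro o
    cases o with
    | none => simp [y]
    | some i =>
      simp only [y, Option.elim]
      rw [le_div_iff₀ (hP0 i)]; linarith [hPM i]
  have hinj : Function.Injective f := by
    intro p q hpq
    have hi : ∀ i, |(p.1 i : ℝ) - q.1 i| < P i := by
      intro i
      have h := congrFun hpq (some i)
      simp only [f, Option.elim] at h
      have h2 := Int.abs_sub_lt_one_of_floor_eq_floor h
      rw [← sub_div, abs_div, abs_of_pos (hP0 i), div_lt_one (hP0 i)] at h2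
      exact h2
    have hn : |((p.2 - q.2 : ℤ) : ℝ) - ∑ i, (((p.1 - q.1) i : ℤ) : ℝ) * α i| < 1 / N := by
      have h := congrFun hpq none
      simp only [f, Option.elim] at h
      have h2 := Int.abs_sub_lt_one_of_floor_eq_floor h
      rw [← mul_sub, abs_mul, abs_of_pos hN0] at h2
      rw [lt_div_iff₀ hN0, mul_comm]
      have e : ((p.2 - q.2 : ℤ) : ℝ) - ∑ i, (((p.1 - q.1) i : ℤ) : ℝ) * α i =
          ((p.2 : ℝ) - ∑ i, (p.1 i : ℝ) * α i) - ((q.2 : ℝ) - ∑ i, (q.1 i : ℝ) * α i) := by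
        simp only [Pi.sub_apply, Int.cast_sub, sub_mul, Finset.sum_sub_distrib]
        ring
      rw [e]
      exact h2
    by_cases hm : p.1 - q.1 = 0
    · have h1 : p.1 = q.1 := sub_eq_zero.mp hm
      rw [hm] at hn
      simp only [Pi.zero_apply, Int.cast_zero, zero_mul, Finset.sum_const_zero, sub_zero] at hn
      have h3 : 1 / N ≤ 1 := by rw [div_le_one hN0]; exact hN
      have h4 : |((p.2 - q.2 : ℤ) : ℝ)| < 1 := by linarith
      have h5 : |p.2 - q.2| < 1 := by exact_mod_cast h4
      have h6 : p.2 = q.2 := by rw [Int.abs_lt_one_iff] at h5; omega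
      exact Prod.ext h1 h6
    · exfalso
      set H := ∏ i, max 1 |(((p.1 - q.1) i : ℤ) : ℝ)| with hH
      have hH1 : H ≤ ∏ i, P i := by
        apply Finset.prod_le_prod
        · intros; positivity
        · intro i _
          apply max_le (hP i)
          have := hi i
          simp only [Pi.sub_apply, Int.cast_sub]
          exact this.le
      have hHpos : 0 < H := Finset.prod_pos (fun i _ => by positivity)
      have hprod : ∏ i, P i ≤ Tp := by
        rcases le_max_iff.mp hPT with h | h
        · exfalso
          -- all `P i = 1`
          obtain ⟨i, hne⟩ : ∃ i, (p.1 - q.1) i ≠ 0 := by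
            by_contra hcon; push Not at hcon; exact hm (funext hcon)
          have h7 : P i ≤ 1 := by
            calc P i ≤ ∏ i, P i := by
                  rw [← Finset.mul_prod_erase _ _ (Finset.mem_univ i)]
                  apply le_mul_of_one_le_right (hP0 i).le
                  calc (1 : ℝ) = ∏ j ∈ Finset.univ.erase i, 1 := by simp
                    _ ≤ _ := Finset.prod_le_prod (fun _ _ => zero_le_one) (fun j _ => hP j)
              _ ≤ 1 := h
          have h8 := hi i
          have h9 : |(((p.1 - q.1) i : ℤ) : ℝ)| < 1 := by
            simp only [Pi.sub_apply, Int.cast_sub]; linarith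
          have h10 : |(p.1 - q.1) i| < 1 := by exact_mod_cast h9
          rw [Int.abs_lt_one_iff] at h10
          exact hne h10
        · exact h
      have hb := hbad (p.1 - q.1) hm (by linarith) (p.2 - q.2)
      rw [← hH] at hb
      have : 1 / N ≤ Tp / (N * H) := by
        rw [div_le_div_iff₀ hN0 (by positivity)]
        nlinarith
      linarith
  have hcs := cell_sum F f hinj.injOn y hy
  calc _ ≤ ∑ p ∈ F, 4 ^ (d + 1) * ∏ o, 1 / (1 + ((f p o : ℝ) / y o) ^ 2) := by
        apply Finset.sum_le_sum
        intro p _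
        rw [Fintype.prod_option, pow_succ (4 : ℝ) d, mul_comm ((4 : ℝ) ^ d) 4]
        have e1 : ∏ i, ((1 + |(p.1 i : ℝ) / M i|)⁻¹) ^ 2 ≤
            4 ^ d * ∏ i : Fin d, 1 / (1 + ((f p (some i) : ℝ) / y (some i)) ^ 2) := by
          have : (4 : ℝ) ^ d = ∏ i : Fin d, 4 := by simp
          rw [this, ← Finset.prod_mul_distrib]
          apply Finset.prod_le_prod
          · intros; positivity
          · intro i _
            apply weight_cell _ _ _ (hy _)
            simp only [f, y, Option.elim]
            have e : M i / P i * |(p.1 i : ℝ) / M i| = |(p.1 i : ℝ) / P i| := by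
              have hMi := hM0 i
              have hPi := hP0 i
              rw [abs_div, abs_div, abs_of_pos (hM0 i), abs_of_pos (hP0 i)]
              field_simp
            rw [e]
            set z := (p.1 i : ℝ) / P i
            have h1 := Int.floor_le z
            have h2 := Int.lt_floor_add_one z
            rw [abs_le]
            have h3 := le_abs_self z
            have h4 := neg_abs_le z
            constructor <;> linarith
        have e2 : ((1 + |N * ((p.2 : ℝ) - ∑ i, (p.1 i : ℝ) * α i)|)⁻¹) ^ 2 ≤
            4 * (1 / (1 + ((f p none : ℝ) / y none) ^ 2)) := by
          apply weight_cell _ _ _ (hy _)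
          simp only [f, y, Option.elim]
          set z := N * ((p.2 : ℝ) - ∑ i, (p.1 i : ℝ) * α i)
          have h1 := Int.floor_le z
          have h2 := Int.lt_floor_add_one z
          rw [abs_le]
          have h3 := le_abs_self z
          have h4 := neg_abs_le z
          constructor <;> linarith
        calc _ ≤ (4 ^ d * ∏ i : Fin d, 1 / (1 + ((f p (some i) : ℝ) / y (some i)) ^ 2)) *
              (4 * (1 / (1 + ((f p none : ℝ) / y none) ^ 2))) := by
              apply mul_le_mul e1 e2 (by positivity) (by positivity)
          _ = _ := by ring
    _ ≤ 4 ^ (d + 1) * ∏ o, (5 * y o) := by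
        rw [← Finset.mul_sum]
        gcongr
    _ = _ := by
        rw [Fintype.prod_option]
        simp only [y, Option.elim]
        rw [Finset.prod_mul_distrib, Finset.prod_div_distrib]
        simp only [Finset.prod_const, Finset.card_univ, Fintype.card_fin]
        rw [show (20 : ℝ) = 4 * 5 by norm_num, mul_pow, pow_succ 5 d]
        ring

lemma lattice_sum (d : ℕ) (α : Fin d → ℝ) (N : ℝ) (hN : 1 ≤ N) (Tp : ℝ) (hTp0 : 0 < Tp)
    (hTpN : Tp ≤ N)
    (hbad : ∀ m : Fin d → ℤ, m ≠ 0 → ∏ i, max 1 |(m i : ℝ)| ≤ N → ∀ n : ℤ,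
      Tp / (N * ∏ i, max 1 |(m i : ℝ)|) ≤ |(n : ℝ) - ∑ i, (m i : ℝ) * α i|)
    (M : Fin d → ℝ) (hM : ∀ i, 1 ≤ M i) (F : Finset ((Fin d → ℤ) × ℤ)) (hF : (0, 0) ∉ F) :
    ∑ p ∈ F, (∏ i, ((1 + |(p.1 i : ℝ) / M i|)⁻¹) ^ 3) *
      ((1 + |N * ((p.2 : ℝ) - ∑ i, (p.1 i : ℝ) * α i)|)⁻¹) ^ 3 ≤
      20 ^ (d + 1) * ((∏ i, M i) / Tp) := by
  have hN0 : 0 < N := by linarith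
  have hM0 : ∀ i, 0 < M i := fun i => by linarith [hM i]
  set T := ∏ i, M i with hT
  have hT0 : 0 < T := Finset.prod_pos (fun i _ => hM0 i)
  have hT1 : 1 ≤ T := by
    calc (1 : ℝ) = ∏ i : Fin d, 1 := by simp
      _ ≤ _ := Finset.prod_le_prod (fun _ _ => zero_le_one) (fun j _ => hM j)
  -- abbreviations
  set W : ((Fin d → ℤ) × ℤ) → ℝ := fun p => (∏ i, (1 + |(p.1 i : ℝ) / M i|)⁻¹) *
      (1 + |N * ((p.2 : ℝ) - ∑ i, (p.1 i : ℝ) * α i)|)⁻¹ with hW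
  have hWe : ∀ (p) (e : ℕ), (∏ i, ((1 + |(p.1 i : ℝ) / M i|)⁻¹) ^ e) *
      ((1 + |N * ((p.2 : ℝ) - ∑ i, (p.1 i : ℝ) * α i)|)⁻¹) ^ e = W p ^ e := by
    intro p e
    simp only [hW]
    rw [mul_pow, Finset.prod_pow]
  have hW0 : ∀ p, 0 < W p := fun p => by
    simp only [hW]
    apply mul_pos
    · exact Finset.prod_pos (fun i _ => by positivity)
    · positivity
  have hW1 : ∀ p, W p ≤ 1 := fun p => by
    simp only [hW]
    apply mul_le_one₀
    · apply Finset.prod_le_one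
      · intros; positivity
      · intro i _; apply inv_le_one_of_one_le₀; linarith [abs_nonneg ((p.1 i : ℝ) / M i)]
    · positivity
    · apply inv_le_one_of_one_le₀
      linarith [abs_nonneg (N * ((p.2 : ℝ) - ∑ i, (p.1 i : ℝ) * α i))]
  simp only [hWe]
  rcases le_or_gt (max 1 Tp) T with hA | hB
  · obtain ⟨P, hP1, hPM, hPp⟩ := exists_shrink M hM (max 1 Tp) (le_max_left _ _) hA
    have h := lattice_sum_cells d α N hN Tp hTpN hbad M P hP1 hPM hPp.le F
    simp only [hWe] at h
    calc ∑ p ∈ F, W p ^ 3 ≤ ∑ p ∈ F, W p ^ 2 :=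
          Finset.sum_le_sum (fun p _ => pow_le_pow_of_le_one (hW0 p).le (hW1 p) (by norm_num))
      _ ≤ _ := h
      _ ≤ _ := by
        rw [hPp]
        gcongr
        exact le_max_right _ _
  · have hTT : T < Tp := by
      rcases lt_max_iff.mp hB with h | h
      · linarith
      · exact h
    have h := lattice_sum_cells d α N hN Tp hTpN hbad M M hM (fun _ => le_rfl) hB.le F
    simp only [hWe] at h
    rw [← hT, div_self hT0.ne', mul_one] at h
    have key : ∀ p ∈ F, W p ≤ T / Tp := by
      intro p hp
      have hp0 : p ≠ (0, 0) := fun h => hF (h ▸ hp)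
      set U := ∏ i, (1 + |(p.1 i : ℝ) / M i|) with hU
      set v := 1 + |N * ((p.2 : ℝ) - ∑ i, (p.1 i : ℝ) * α i)| with hv
      have hWU : W p = (U * v)⁻¹ := by
        simp only [hW]
        rw [Finset.prod_inv_distrib, mul_inv]
      have hU1 : 1 ≤ U := by
        calc (1 : ℝ) = ∏ i : Fin d, 1 := by simp
          _ ≤ _ := Finset.prod_le_prod (fun _ _ => zero_le_one)
            (fun j _ => by linarith [abs_nonneg ((p.1 j : ℝ) / M j)])
      have hv1 : 1 ≤ v := by
        rw [hv]; linarith [abs_nonneg (N * ((p.2 : ℝ) - ∑ i, (p.1 i : ℝ) * α i))]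
      rw [hWU, ← inv_div]
      apply inv_anti₀ (by positivity)
      rw [div_le_iff₀ hT0]
      by_cases hm : p.1 = 0
      · have hn : p.2 ≠ 0 := fun h => hp0 (Prod.ext hm h)
        have hv2 : N ≤ v := by
          rw [hv, hm]
          simp only [Pi.zero_apply, Int.cast_zero, zero_mul, Finset.sum_const_zero, sub_zero,
            abs_mul, abs_of_pos hN0]
          have : (1 : ℝ) ≤ |(p.2 : ℝ)| := by exact_mod_cast Int.one_le_abs hn
          nlinarith
        nlinarith [mul_le_mul hU1 hv2 (by linarith) (by linarith)]
      · set H := ∏ i, max 1 |(p.1 i : ℝ)| with hH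
        have hHpos : 0 < H := Finset.prod_pos (fun i _ => by positivity)
        have hHTU : H ≤ T * U := by
          rw [hT, hU, ← Finset.prod_mul_distrib]
          apply Finset.prod_le_prod
          · intros; positivity
          · intro i _
            have hMi := hM0 i
            have e : M i * (1 + |(p.1 i : ℝ) / M i|) = M i + |(p.1 i : ℝ)| := by
              rw [abs_div, abs_of_pos hMi]; field_simp
            rw [e]
            apply max_le
            · linarith [hM i, abs_nonneg (p.1 i : ℝ)]
            · linarith
        rcases le_or_gt H N with hHN | hHN
        · have hb := hbad p.1 hm hHN p.2
          rw [← hH] at hb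
          have hv2 : Tp / H ≤ v := by
            rw [hv, abs_mul, abs_of_pos hN0]
            have : N * (Tp / (N * H)) = Tp / H := by field_simp
            nlinarith [mul_le_mul_of_nonneg_left hb hN0.le]
          rw [div_le_iff₀ hHpos] at hv2
          nlinarith [mul_le_mul_of_nonneg_left hHTU (by linarith : (0:ℝ) ≤ v)]
        · nlinarith [mul_le_mul_of_nonneg_left hv1 (by positivity : (0 : ℝ) ≤ T * U)]
    calc ∑ p ∈ F, W p ^ 3 ≤ ∑ p ∈ F, (T / Tp) * W p ^ 2 := by
          apply Finset.sum_le_sum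
          intro p hp
          rw [pow_succ, mul_comm]
          exact mul_le_mul_of_nonneg_right (key p hp) (by positivity)
      _ ≤ _ := by
        rw [← Finset.mul_sum, mul_comm]
        gcongr

lemma fhat_eq_fourier (w : ℝ → ℝ) (ξ : ℝ) :
    fhat w ξ = FourierTransform.fourier (fun x : ℝ => (w x : ℂ)) ξ := by
  rw [Real.fourier_real_eq_integral_exp_smul]
  unfold fhat
  congr 1
  ext x
  rw [smul_eq_mul, mul_comm]
  congr 2
  push_cast
  ring

lemma fhat_decay (w : ℝ → ℝ) (hs : Function.support w ⊆ Set.Icc (-2 : ℝ) 2)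
    (hw : ContDiff ℝ 3 w) :
    ∃ C : ℝ, 0 < C ∧ ∀ ξ, ‖fhat w ξ‖ ≤ C * ((1 + |ξ|)⁻¹) ^ 3 := by
  set f : ℝ → ℂ := fun x => (w x : ℂ) with hf
  have hfc : ContDiff ℝ 3 f := Complex.ofRealCLM.contDiff.comp hw
  have hcs : HasCompactSupport f := by
    apply HasCompactSupport.of_support_subset_isCompact (isCompact_Icc (a := (-2 : ℝ)) (b := 2))
    intro x hx
    apply hs
    simp only [hf, Function.mem_support, ne_eq, Complex.ofReal_eq_zero] at hx
    exact hx
  have hIntegr : ∀ n : ℕ, (n : ℕ∞) ≤ (3 : ℕ∞) → MeasureTheory.Integrable (iteratedDeriv n f) := by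
    intro n hn
    apply Continuous.integrable_of_hasCompactSupport
    · apply hfc.continuous_iteratedDeriv
      exact_mod_cast hn
    · clear hn
      induction n with
      | zero => simpa using hcs
      | succ n ih => rw [iteratedDeriv_succ]; exact ih.deriv
  have h3 := Real.fourier_iteratedDeriv (N := 3) (n := 3) (f := f) (by exact_mod_cast hfc) hIntegr le_rfl
  set I0 := ∫ x, ‖f x‖ with hI0
  set I3 := ∫ x, ‖iteratedDeriv 3 f x‖ with hI3
  have hI0n : 0 ≤ I0 := MeasureTheory.integral_nonneg (fun _ => norm_nonneg _)
  have hI3n : 0 ≤ I3 := MeasureTheory.integral_nonneg (fun _ => norm_nonneg _)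
  have hbd : ∀ (g : ℝ → ℂ) (ξ : ℝ), ‖FourierTransform.fourier g ξ‖ ≤ ∫ x, ‖g x‖ := by
    intro g ξ
    rw [Real.fourier_real_eq]
    refine (MeasureTheory.norm_integral_le_integral_norm _).trans (le_of_eq ?_)
    congr 1; ext x
    rw [Circle.norm_smul]
  refine ⟨8 * (I0 + I3 + 1), by positivity, fun ξ => ?_⟩
  rw [fhat_eq_fourier]
  set A := ‖FourierTransform.fourier f ξ‖ with hA
  have hA0 : 0 ≤ A := norm_nonneg _
  have a1 : A ≤ I0 := hbd f ξ
  have a2 : |ξ| ^ 3 * A ≤ I3 := by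
    have := hbd (iteratedDeriv 3 f) ξ
    rw [h3] at this
    simp only [norm_smul, norm_pow, norm_mul, Complex.norm_real, Complex.norm_I, mul_one,
      Complex.norm_ofNat, Real.norm_eq_abs] at this
    refine le_trans ?_ this
    gcongr
    rw [abs_of_pos Real.pi_pos]
    have : (1 : ℝ) ≤ 2 * Real.pi := by linarith [Real.pi_gt_three]
    nlinarith [abs_nonneg ξ]
  have hx := abs_nonneg ξ
  rw [inv_pow, ← div_eq_mul_inv, le_div_iff₀ (by positivity)]
  have e : (1 + |ξ|) ^ 3 ≤ 8 * (1 + |ξ| ^ 3) := by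
    nlinarith [sq_nonneg (|ξ| - 1), mul_nonneg hx (sq_nonneg (|ξ| - 1))]
  nlinarith [mul_le_mul_of_nonneg_left e hA0]

lemma summable_inv_sq : Summable (fun c : ℤ => 1 / (1 + (c : ℝ) ^ 2)) := by
  apply summable_of_sum_le (c := 5)
  · intro c; positivity
  · intro F
    simpa using sum_inv 1 le_rfl F

lemma decay_summable (w : ℝ → ℝ) (C : ℝ) (hC : ∀ ξ, ‖fhat w ξ‖ ≤ C * ((1 + |ξ|)⁻¹) ^ 3)
    (ρ β : ℝ) (hρ : 0 < ρ) : Summable (fun n : ℤ => ‖(ρ : ℂ) * fhat w (ρ * (n - β))‖) := by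
  have hC0 : 0 ≤ C := by
    have := hC 0
    simp only [abs_zero, add_zero, inv_one, one_pow, mul_one] at this
    exact (norm_nonneg _).trans this
  set K := 1 + |β| + 1 / ρ with hK
  have hK1 : 1 ≤ K := by
    have : 0 < 1 / ρ := by positivity
    linarith [abs_nonneg β]
  apply Summable.of_nonneg_of_le (fun _ => norm_nonneg _) (f := fun c : ℤ => ρ * C * K ^ 2 * (1 / (1 + (c : ℝ) ^ 2)))
  · intro n
    rw [norm_mul, Complex.norm_real, Real.norm_eq_abs, abs_of_pos hρ]
    have h1 := hC (ρ * (n - β))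
    rw [abs_mul, abs_of_pos hρ] at h1
    set t := |(n : ℝ) - β| with ht
    have ht0 : 0 ≤ t := abs_nonneg _
    have h2 : 1 + |(n : ℝ)| ≤ K * (1 + ρ * t) := by
      have : |(n : ℝ)| ≤ t + |β| := by
        have := abs_add_le ((n : ℝ) - β) β
        simpa using this
      have e : K * (1 + ρ * t) = 1 + |β| + 1 / ρ + (1 + |β|) * (ρ * t) + t := by
        rw [hK]; field_simp; ring
      rw [e]
      have : 0 < 1 / ρ := by positivity
      have : 0 ≤ (1 + |β|) * (ρ * t) := by positivity
      linarith
    have h3 : ((1 + ρ * t)⁻¹) ^ 3 ≤ K ^ 2 * (1 / (1 + (n : ℝ) ^ 2)) := by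
      have hp : 0 < 1 + ρ * t := by positivity
      calc ((1 + ρ * t)⁻¹) ^ 3 ≤ ((1 + ρ * t)⁻¹) ^ 2 := by
            apply pow_le_pow_of_le_one (by positivity)
            · apply inv_le_one_of_one_le₀; nlinarith [mul_nonneg hρ.le ht0]
            · norm_num
        _ ≤ _ := by
            rw [inv_pow, mul_one_div, inv_eq_one_div, div_le_div_iff₀ (by positivity) (by positivity)]
            have h4 := pow_le_pow_left₀ (by positivity) h2 2
            have h5 := sq_abs (n : ℝ)
            nlinarith [abs_nonneg (n : ℝ)]
    calc ρ * ‖fhat w (ρ * (n - β))‖ ≤ ρ * (C * ((1 + ρ * t)⁻¹) ^ 3) := by gcongr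
      _ ≤ ρ * (C * (K ^ 2 * (1 / (1 + (n : ℝ) ^ 2)))) := by gcongr
      _ = _ := by ring
  · exact summable_inv_sq.mul_left _

lemma poisson1 (w : ℝ → ℝ) (hs : Function.support w ⊆ Set.Icc (-2 : ℝ) 2)
    (hw : ContDiff ℝ 3 w) (ρ β x : ℝ) (hρ : 0 < ρ) :
    ∑' n : ℤ, (w ((x + n) / ρ) : ℂ) * Complex.exp (2 * Real.pi * Complex.I * β * (x + n)) =
      ∑' n : ℤ, (ρ : ℂ) * fhat w (ρ * (n - β)) * Complex.exp (2 * Real.pi * Complex.I * n * x) := by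
  obtain ⟨C, hC0, hC⟩ := fhat_decay w hs hw
  set f : ℝ → ℂ := fun x => (w (x / ρ) : ℂ) * Complex.exp (2 * Real.pi * Complex.I * β * x) with hf
  have hF : ∀ n : ℝ, FourierTransform.fourier f n = (ρ : ℂ) * fhat w (ρ * (n - β)) := by
    intro n
    rw [Real.fourier_real_eq_integral_exp_smul]
    have h := MeasureTheory.Measure.integral_comp_div
      (fun u : ℝ => (w u : ℂ) * Complex.exp (-(2 * Real.pi * Complex.I * (ρ * (n - β) : ℝ) * u))) ρ
    rw [abs_of_pos hρ] at h
    unfold fhat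
    rw [← Complex.real_smul, ← h]
    congr 1
    ext v
    simp only [hf, smul_eq_mul]
    rw [mul_comm, mul_assoc, ← Complex.exp_add]
    congr 2
    have : (ρ : ℂ) ≠ 0 := by exact_mod_cast hρ.ne'
    push_cast
    field_simp
    ring
  have hcont : Continuous f := by
    have := hw.continuous
    simp only [hf]
    fun_prop
  have hzero : f =ᶠ[Filter.cocompact ℝ] 0 := by
    have : (Set.Icc (-(2 * ρ)) (2 * ρ))ᶜ ∈ Filter.cocompact ℝ := isCompact_Icc.compl_mem_cocompact
    filter_upwards [this] with v hv
    simp only [hf, Pi.zero_apply, mul_eq_zero, Complex.ofReal_eq_zero]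
    left
    by_contra hne
    have := hs hne
    apply hv
    rw [Set.mem_Icc, le_div_iff₀ hρ, div_le_iff₀ hρ] at this
    exact ⟨by linarith [this.1], this.2⟩
  have hsum : Summable fun n : ℤ => FourierTransform.fourier f (n : ℝ) := by
    apply Summable.of_norm
    simp only [hF]
    exact decay_summable w C hC ρ β hρ
  have h := Real.tsum_eq_tsum_fourier_of_rpow_decay_of_summable hcont (b := 2) (by norm_num)
    (hzero.trans_isBigO (Asymptotics.isBigO_zero _ _)) hsum x
  simp only [hf] at h
  push_cast at h
  rw [h]
  congr 1
  ext n
  rw [fourier_coe_apply, ← hf, hF]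
  congr 2
  push_cast
  ring

lemma tsum_pi_prod : ∀ (n : ℕ) (f : Fin n → ℤ → ℂ) (_ : ∀ i, Summable (fun a => ‖f i a‖)),
    Summable (fun m : Fin n → ℤ => ‖∏ i, f i (m i)‖) ∧
      ∑' m : Fin n → ℤ, ∏ i, f i (m i) = ∏ i, ∑' a, f i a := by
  intro n
  induction n with
  | zero =>
    intro f _
    refine ⟨(hasSum_fintype _).summable, ?_⟩
    simp
  | succ n ih =>
    intro f hf
    obtain ⟨h1, h2⟩ := ih (fun i => f i.succ) (fun i => hf i.succ)
    let e : ℤ × (Fin n → ℤ) ≃ (Fin (n + 1) → ℤ) := Fin.consEquiv (fun _ => ℤ)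
    have he : ∀ p : ℤ × (Fin n → ℤ), ∏ i, f i (e p i) = f 0 p.1 * ∏ i : Fin n, f i.succ (p.2 i) := by
      intro p
      rw [Fin.prod_univ_succ]
      simp [e, Fin.consEquiv]
    constructor
    · rw [← e.summable_iff]
      have : (fun m : Fin (n + 1) → ℤ => ‖∏ i, f i (m i)‖) ∘ e =
          fun p => ‖f 0 p.1 * ∏ i : Fin n, f i.succ (p.2 i)‖ := by
        ext p; simp only [Function.comp, he]
      rw [this]
      exact Summable.mul_norm (f := f 0) (g := fun q : Fin n → ℤ => ∏ i : Fin n, f i.succ (q i))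
        (hf 0) h1
    · rw [← e.tsum_eq]
      simp only [he]
      rw [Fin.prod_univ_succ, ← h2]
      exact (tsum_mul_tsum_of_summable_norm (f := f 0)
        (g := fun q : Fin n → ℤ => ∏ i : Fin n, f i.succ (q i)) (hf 0) h1).symm

/-- The additive character. -/
noncomputable def ech (t : ℝ) : ℂ := Complex.exp (((2 * Real.pi * t : ℝ) : ℂ) * Complex.I)

lemma ech_add (s t : ℝ) : ech (s + t) = ech s * ech t := by
  unfold ech; rw [← Complex.exp_add]; congr 1; push_cast; ring

lemma ech_zero : ech 0 = 1 := by simp [ech]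

lemma ech_int (n : ℤ) : ech n = 1 := by
  unfold ech
  rw [Complex.exp_eq_one_iff]
  exact ⟨n, by push_cast; ring⟩

lemma ech_norm (t : ℝ) : ‖ech t‖ = 1 := Complex.norm_exp_ofReal_mul_I _

lemma ech_conj (t : ℝ) : (starRingEnd ℂ) (ech t) = ech (-t) := by
  unfold ech
  rw [← Complex.exp_conj]; congr 1
  rw [map_mul, Complex.conj_ofReal, Complex.conj_I]; push_cast; ring

lemma ech_re (t : ℝ) : (ech t).re = Real.cos (2 * Real.pi * t) := by
  unfold ech; exact Complex.exp_ofReal_mul_I_re _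

lemma ech_sum {ι : Type*} (s : Finset ι) (g : ι → ℝ) : ech (∑ i ∈ s, g i) = ∏ i ∈ s, ech (g i) := by
  classical
  induction s using Finset.induction_on with
  | empty => simp [ech_zero]
  | insert a s ha ih => rw [Finset.sum_insert ha, Finset.prod_insert ha, ech_add, ih]

lemma ech_natmul (u : ℕ) (y : ℝ) : ech (u * y) = ech y ^ u := by
  induction u with
  | zero => simp [ech_zero]
  | succ n ih => rw [pow_succ, ← ih, ← ech_add]; congr 1; push_cast; ring

lemma geom_bound (x : ℝ) (M : ℕ) (hM : 1 ≤ M) :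
    ‖∑ u ∈ Finset.range (2 * M), ech (u * x)‖ ^ 2 ≤
      16 * (M : ℝ) ^ 2 * (1 / (1 + ((⌊M * (x - round x)⌋ : ℤ) : ℝ) ^ 2)) := by
  set y := x - round x with hy
  set c : ℤ := ⌊M * y⌋ with hc
  have hM' : (1 : ℝ) ≤ M := by exact_mod_cast hM
  have hyb : |y| ≤ 1 / 2 := abs_sub_round x
  have htriv : ‖∑ u ∈ Finset.range (2 * M), ech (u * x)‖ ≤ 2 * M := by
    calc _ ≤ ∑ u ∈ Finset.range (2 * M), ‖ech (u * x)‖ := norm_sum_le _ _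
      _ = 2 * M := by simp [ech_norm]
  by_cases hc1 : |c| ≤ 1
  · have h1 : (c : ℝ) ^ 2 ≤ 1 := by
      have : c ^ 2 ≤ 1 := by
        rw [← sq_abs]; have := abs_nonneg c; nlinarith
      exact_mod_cast this
    have h2 : ‖∑ u ∈ Finset.range (2 * M), ech (u * x)‖ ^ 2 ≤ (2 * M) ^ 2 :=
      pow_le_pow_left₀ (norm_nonneg _) htriv 2
    refine h2.trans ?_
    rw [mul_one_div, le_div_iff₀ (by positivity)]
    nlinarith [sq_nonneg (M : ℝ)]
  · push Not at hc1
    have hc2 : (2 : ℝ) ≤ |(c : ℝ)| := by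
      have : (2 : ℤ) ≤ |c| := by omega
      exact_mod_cast this
    have hlow : (c : ℝ) ≤ M * y := Int.floor_le _
    have hup : M * y < c + 1 := Int.lt_floor_add_one _
    have hMy : |(c : ℝ)| / 2 ≤ M * |y| := by
      rw [← Nat.abs_cast M, ← abs_mul]
      rcases le_total 0 (c : ℝ) with h | h
      · rw [abs_of_nonneg h] at *
        have := le_abs_self (M * y); linarith
      · rw [abs_of_nonpos h] at *
        have := neg_le_abs (M * y); linarith
    have hypos : 0 < |y| := by
      by_contra h
      have : |y| = 0 := le_antisymm (not_lt.mp h) (abs_nonneg _)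
      rw [this] at hMy; linarith
    have hxy : ∀ u : ℕ, ech (u * x) = ech y ^ u := by
      intro u
      rw [← ech_natmul, show (u : ℝ) * x = u * y + ((u * round x : ℤ) : ℝ) by push_cast; rw [hy]; ring,
        ech_add, ech_int, mul_one]
    have hsin : 2 * |y| ≤ |Real.sin (Real.pi * y)| := by
      have hpi := Real.pi_pos
      have := Real.mul_abs_le_abs_sin (x := Real.pi * y) (by
        rw [abs_mul, abs_of_pos hpi]; nlinarith)
      rw [abs_mul, abs_of_pos hpi] at this
      calc 2 * |y| = 2 / Real.pi * (Real.pi * |y|) := by field_simp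
        _ ≤ _ := this
    have hden : ‖ech y - 1‖ = 2 * |Real.sin (Real.pi * y)| := by
      have := Complex.norm_exp_I_mul_ofReal_sub_one (2 * Real.pi * y)
      unfold ech
      rw [mul_comm, this, norm_mul, Real.norm_eq_abs, Real.norm_eq_abs]
      congr 2
      · norm_num
      · congr 1; ring
    have hne : ech y ≠ 1 := by
      intro h
      rw [h, sub_self, norm_zero] at hden
      linarith
    have hg : ‖∑ u ∈ Finset.range (2 * M), ech (u * x)‖ ≤ 1 / (2 * |y|) := by
      simp only [hxy]
      rw [geom_sum_eq hne, norm_div, hden]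
      have hnum : ‖ech y ^ (2 * M) - 1‖ ≤ 2 := by
        calc _ ≤ ‖ech y ^ (2 * M)‖ + ‖(1 : ℂ)‖ := norm_sub_le _ _
          _ = 2 := by rw [norm_pow, ech_norm]; norm_num
      rw [div_le_div_iff₀ (by linarith) (by linarith)]
      nlinarith
    have hg2 : ‖∑ u ∈ Finset.range (2 * M), ech (u * x)‖ ^ 2 ≤ (1 / (2 * |y|)) ^ 2 :=
      pow_le_pow_left₀ (norm_nonneg _) hg 2
    refine hg2.trans ?_
    rw [mul_one_div, div_pow, one_pow, div_le_div_iff₀ (by positivity) (by positivity)]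
    have h4 : (c : ℝ) ^ 2 ≤ 4 * (M * |y|) ^ 2 := by
      rw [← sq_abs (c : ℝ)]; nlinarith
    have h5 : (1 : ℝ) ≤ (c : ℝ) ^ 2 := by rw [← sq_abs (c : ℝ)]; nlinarith
    nlinarith

lemma frob_dual {ι κ : Type*} (U : Finset ι) (R : Finset κ) (X : κ → ι → ℂ) :
    ∑ u ∈ U, ∑ v ∈ U, ‖∑ q ∈ R, X q u * (starRingEnd ℂ) (X q v)‖ ^ 2 =
    ∑ q ∈ R, ∑ r ∈ R, ‖∑ u ∈ U, X q u * (starRingEnd ℂ) (X r u)‖ ^ 2 := by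
  have key : ∀ z : ℂ, ((‖z‖ ^ 2 : ℝ) : ℂ) = z * (starRingEnd ℂ) z := by
    intro z; rw [Complex.mul_conj, Complex.normSq_eq_norm_sq]
  rw [← Complex.ofReal_inj]
  push_cast
  simp only [← Complex.ofReal_pow, key, map_sum, map_mul, Complex.conj_conj, Finset.sum_mul_sum]
  calc _ = ∑ u ∈ U, ∑ q ∈ R, ∑ r ∈ R, ∑ v ∈ U, (X q u * (starRingEnd ℂ) (X q v)) *
        ((starRingEnd ℂ) (X r u) * X r v) := by
        apply Finset.sum_congr rfl; intro u _
        rw [Finset.sum_comm]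
        apply Finset.sum_congr rfl; intro q _
        rw [Finset.sum_comm]
    _ = ∑ q ∈ R, ∑ r ∈ R, ∑ u ∈ U, ∑ v ∈ U, (X q u * (starRingEnd ℂ) (X q v)) *
        ((starRingEnd ℂ) (X r u) * X r v) := by
        rw [Finset.sum_comm]
        apply Finset.sum_congr rfl; intro u _
        rw [Finset.sum_comm]
    _ = _ := by
        apply Finset.sum_congr rfl; intro q _
        apply Finset.sum_congr rfl; intro r _
        apply Finset.sum_congr rfl; intro u _
        apply Finset.sum_congr rfl; intro v _
        ring

lemma large_sieve (d : ℕ) (α : Fin d → ℝ) (M : Fin d → ℕ) (hM : ∀ i, 1 ≤ M i) (Qn : ℕ) (hQ : 1 ≤ Qn)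
    (hsep : ∀ q : ℕ, 1 ≤ q → q < Qn → ∃ i, ∀ n : ℤ, 1 / (M i : ℝ) ≤ |q * α i - n|)
    (S : Finset (Fin d → ℤ)) (hS : ∀ m ∈ S, (∀ i, |m i| ≤ (M i : ℤ)) ∧
      ∃ n : ℤ, Qn * |∑ i, (m i : ℝ) * α i - n| ≤ 1 / 6) :
    (S.card : ℝ) * Qn ≤ 4 * 80 ^ d * ∏ i, (M i : ℝ) := by
  classical
  set T : ℝ := ∏ i, (M i : ℝ) with hT
  have hM' : ∀ i, (1 : ℝ) ≤ M i := fun i => by exact_mod_cast hM i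
  have hTpos : 0 < T := Finset.prod_pos (fun i _ => by linarith [hM' i])
  set U : Finset (Fin d → ℕ) := Fintype.piFinset (fun i => Finset.range (2 * M i)) with hU
  set R := Finset.range Qn with hR
  set X : ℕ → (Fin d → ℕ) → ℂ := fun q u => ech (q * ∑ i, (u i : ℝ) * α i) with hX
  have hdual := frob_dual U R X
  have hQ0 : (0 : ℝ) < Qn := by exact_mod_cast hQ
  -- lower bound
  have hlow : (S.card : ℝ) * T * ((Qn : ℝ) / 2) ^ 2 ≤
      ∑ u ∈ U, ∑ v ∈ U, ‖∑ q ∈ R, X q u * (starRingEnd ℂ) (X q v)‖ ^ 2 := by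
    set V : Finset (Fin d → ℕ) := Fintype.piFinset (fun i => Finset.range (M i)) with hV
    have hVc : (V.card : ℝ) = T := by
      rw [hV, Fintype.card_piFinset]; push_cast; simp [hT]
    set P := S ×ˢ V with hP
    let f : (Fin d → ℤ) × (Fin d → ℕ) → (Fin d → ℕ) × (Fin d → ℕ) := fun p =>
      (fun i => p.2 i + (p.1 i).toNat, fun i => p.2 i + (-(p.1 i)).toNat)
    have hfinj : Set.InjOn f P := by
      rintro ⟨m, t⟩ _ ⟨m', t'⟩ _ h
      simp only [f, Prod.mk.injEq, funext_iff] at h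
      have hm : m = m' := by
        ext i; have := h.1 i; have := h.2 i; omega
      have ht : t = t' := by
        ext i; have := h.1 i; have := h.2 i; rw [hm] at *; omega
      rw [hm, ht]
    have hfm : ∀ p ∈ P, f p ∈ U ×ˢ U := by
      rintro ⟨m, t⟩ hp
      rw [hP, Finset.mem_product] at hp
      have h1 := (hS m hp.1).1
      have h2 : ∀ i, t i < M i := by simpa [hV] using hp.2
      simp only [f, hU, Finset.mem_product, Fintype.mem_piFinset, Finset.mem_range]
      constructor <;> intro i <;> have := h1 i <;> have := h2 i <;> rw [abs_le] at * <;> omega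
    have hfb : ∀ p ∈ P, ((Qn : ℝ) / 2) ^ 2 ≤
        ‖∑ q ∈ R, X q (f p).1 * (starRingEnd ℂ) (X q (f p).2)‖ ^ 2 := by
      rintro ⟨m, t⟩ hp
      rw [hP, Finset.mem_product] at hp
      obtain ⟨n, hn⟩ := (hS m hp.1).2
      apply pow_le_pow_left₀ (by positivity)
      refine le_trans ?_ (Complex.re_le_norm _)
      rw [Complex.re_sum]
      have : ∀ q ∈ R, (1 : ℝ) / 2 ≤ (X q (f (m, t)).1 * (starRingEnd ℂ) (X q (f (m, t)).2)).re := by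
        intro q hq
        have hq' : (q : ℝ) ≤ Qn := by
          have := Finset.mem_range.mp hq
          exact_mod_cast this.le
        have e1 : X q (f (m, t)).1 * (starRingEnd ℂ) (X q (f (m, t)).2) =
            ech (q * (∑ i, (m i : ℝ) * α i - n)) := by
          simp only [hX, f]
          rw [ech_conj, ← ech_add]
          have : (q : ℝ) * ∑ i, ((t i + (m i).toNat : ℕ) : ℝ) * α i +
            -((q : ℝ) * ∑ i, ((t i + (-(m i)).toNat : ℕ) : ℝ) * α i) =
            q * (∑ i, (m i : ℝ) * α i - n) + ((q * n : ℤ) : ℝ) := by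
            rw [← mul_neg, ← mul_add, ← Finset.sum_neg_distrib, ← Finset.sum_add_distrib]
            have : ∀ i, ((t i + (m i).toNat : ℕ) : ℝ) * α i +
              -(((t i + (-(m i)).toNat : ℕ) : ℝ) * α i) = (m i : ℝ) * α i := by
              intro i
              have : ((m i).toNat : ℤ) - ((-(m i)).toNat : ℤ) = m i := by omega
              have : ((m i).toNat : ℝ) - ((-(m i)).toNat : ℝ) = m i := by exact_mod_cast this
              push_cast
              rw [← this]; ring
            simp only [this]
            push_cast; ring
          rw [this, ech_add, ech_int, mul_one]
        rw [e1, ech_re, ← Real.cos_abs]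
        have habs : |2 * Real.pi * (q * (∑ i, (m i : ℝ) * α i - n))| ≤ Real.pi / 3 := by
          rw [abs_mul, abs_of_pos (by positivity : 0 < 2 * Real.pi), abs_mul, Nat.abs_cast]
          have : (q : ℝ) * |∑ i, (m i : ℝ) * α i - n| ≤ 1 / 6 :=
            le_trans (by gcongr) hn
          have hpi := Real.pi_pos
          nlinarith
        rw [← Real.cos_pi_div_three]
        exact Real.cos_le_cos_of_nonneg_of_le_pi (abs_nonneg _) (by linarith [Real.pi_pos]) habs
      calc (Qn : ℝ) / 2 = ∑ q ∈ R, (1 : ℝ) / 2 := by simp [hR]; ring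
        _ ≤ _ := Finset.sum_le_sum this
    calc (S.card : ℝ) * T * ((Qn : ℝ) / 2) ^ 2 = ∑ p ∈ P, ((Qn : ℝ) / 2) ^ 2 := by
          rw [Finset.sum_const, nsmul_eq_mul, hP, Finset.card_product]; push_cast; rw [hVc]
      _ ≤ ∑ p ∈ P, ‖∑ q ∈ R, X q (f p).1 * (starRingEnd ℂ) (X q (f p).2)‖ ^ 2 :=
          Finset.sum_le_sum hfb
      _ = ∑ uv ∈ P.image f, ‖∑ q ∈ R, X q uv.1 * (starRingEnd ℂ) (X q uv.2)‖ ^ 2 := by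
          rw [Finset.sum_image hfinj]
      _ ≤ ∑ uv ∈ U ×ˢ U, ‖∑ q ∈ R, X q uv.1 * (starRingEnd ℂ) (X q uv.2)‖ ^ 2 := by
          apply Finset.sum_le_sum_of_subset_of_nonneg
          · intro x hx
            obtain ⟨p, hp, rfl⟩ := Finset.mem_image.mp hx
            exact hfm p hp
          · intros; positivity
      _ = _ := by rw [Finset.sum_product]
  -- upper bound
  have hup : ∀ r ∈ R, ∑ q ∈ R, ‖∑ u ∈ U, X q u * (starRingEnd ℂ) (X r u)‖ ^ 2 ≤ 80 ^ d * T ^ 2 := by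
    intro r hr
    set c : ℕ → Fin d → ℤ := fun q i =>
      ⌊M i * (((q : ℝ) - r) * α i - round (((q : ℝ) - r) * α i))⌋ with hc
    have hcinj0 : ∀ q ∈ R, ∀ q' ∈ R, q' < q → c q ≠ c q' := by
      intro q hq q' hq' hlt heq
      rw [hR, Finset.mem_range] at hq hq'
      obtain ⟨i, hi⟩ := hsep (q - q') (by omega) (by omega)
      have h := congrFun heq i
      simp only [hc] at h
      have := Int.abs_sub_lt_one_of_floor_eq_floor h
      rw [← mul_sub, abs_mul, Nat.abs_cast] at this
      have h2 := hi (round (((q : ℝ) - r) * α i) - round (((q' : ℝ) - r) * α i))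
      rw [div_le_iff₀ (by linarith [hM' i])] at h2
      rw [Nat.cast_sub hlt.le] at h2
      push_cast at h2
      have e : ((q : ℝ) - q') * α i - ((round (((q : ℝ) - r) * α i) : ℝ) -
        round (((q' : ℝ) - r) * α i)) = ((q : ℝ) - r) * α i - round (((q : ℝ) - r) * α i) -
        (((q' : ℝ) - r) * α i - round (((q' : ℝ) - r) * α i)) := by ring
      rw [e] at h2
      linarith
    have hcinj : Set.InjOn c R := by
      intro q hq q' hq' heq
      rcases lt_trichotomy q q' with h | h | h
      · exact absurd heq.symm (hcinj0 q' hq' q hq h)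
      · exact h
      · exact absurd heq (hcinj0 q hq q' hq' h)
    have hA : ∀ q ∈ R, ‖∑ u ∈ U, X q u * (starRingEnd ℂ) (X r u)‖ ^ 2 ≤
        (∏ i, 16 * (M i : ℝ) ^ 2) * ∏ i, 1 / (1 + ((c q i : ℝ) / 1) ^ 2) := by
      intro q hq
      have e : ∑ u ∈ U, X q u * (starRingEnd ℂ) (X r u) =
          ∏ i, ∑ u ∈ Finset.range (2 * M i), ech (u * (((q : ℝ) - r) * α i)) := by
        rw [Finset.prod_univ_sum]
        apply Finset.sum_congr rfl
        intro u _
        simp only [hX]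
        rw [ech_conj, ← ech_add, ← ech_sum]
        congr 1
        rw [← neg_mul, ← add_mul, Finset.mul_sum]
        apply Finset.sum_congr rfl
        intro i _
        ring
      rw [e, norm_prod, ← Finset.prod_pow, ← Finset.prod_mul_distrib]
      apply Finset.prod_le_prod
      · intros; positivity
      · intro i _
        have := geom_bound (((q : ℝ) - r) * α i) (M i) (hM i)
        rw [div_one]
        exact this
    calc _ ≤ ∑ q ∈ R, (∏ i, 16 * (M i : ℝ) ^ 2) * ∏ i, 1 / (1 + ((c q i : ℝ) / 1) ^ 2) :=
          Finset.sum_le_sum hA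
      _ = (∏ i, 16 * (M i : ℝ) ^ 2) * ∑ q ∈ R, ∏ i, 1 / (1 + ((c q i : ℝ) / 1) ^ 2) := by
          rw [Finset.mul_sum]
      _ ≤ (∏ i, 16 * (M i : ℝ) ^ 2) * ∏ i : Fin d, (5 * (1 : ℝ)) := by
          gcongr
          exact cell_sum R c hcinj (fun _ => 1) (fun _ => le_rfl)
      _ = 80 ^ d * T ^ 2 := by
          rw [Finset.prod_mul_distrib, Finset.prod_pow, hT]
          simp only [Finset.prod_const, Finset.card_univ, Fintype.card_fin, mul_one]
          rw [show (80 : ℝ) = 16 * 5 by norm_num, mul_pow]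
          ring
  have hup2 : ∑ q ∈ R, ∑ r ∈ R, ‖∑ u ∈ U, X q u * (starRingEnd ℂ) (X r u)‖ ^ 2 ≤
      Qn * (80 ^ d * T ^ 2) := by
    rw [Finset.sum_comm]
    calc _ ≤ ∑ r ∈ R, (80 : ℝ) ^ d * T ^ 2 := Finset.sum_le_sum hup
      _ = _ := by rw [Finset.sum_const, nsmul_eq_mul, hR, Finset.card_range]
  have h := hlow.trans (hdual.le.trans hup2)
  have hpos : 0 < T * Qn / 4 := by positivity
  refine le_of_mul_le_mul_right ?_ hpos
  calc (S.card : ℝ) * Qn * (T * Qn / 4) = S.card * T * ((Qn : ℝ) / 2) ^ 2 := by ring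
    _ ≤ _ := h
    _ = _ := by ring

lemma weight_finite (w : ℝ → ℝ) (hs : Function.support w ⊆ Set.Icc (-2 : ℝ) 2) (ρ : ℝ) (hρ : 0 < ρ)
    (x : ℝ) : {a : ℤ | w ((x + a) / ρ) ≠ 0}.Finite := by
  apply (Set.finite_Icc (⌊-2 * ρ - x⌋) (⌈2 * ρ - x⌉)).subset
  intro a ha
  have := hs (show w ((x + a) / ρ) ≠ 0 from ha)
  rw [Set.mem_Icc, le_div_iff₀ hρ, div_le_iff₀ hρ] at this
  constructor
  · have : ((⌊-2 * ρ - x⌋ : ℤ) : ℝ) ≤ a := (Int.floor_le _).trans (by linarith)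
    exact_mod_cast this
  · have : (a : ℝ) ≤ ((⌈2 * ρ - x⌉ : ℤ) : ℝ) := le_trans (by linarith) (Int.le_ceil _)
    exact_mod_cast this

set_option maxHeartbeats 1600000 in
lemma disc_bound (d : ℕ) (w : Fin (d+1) → ℝ → ℝ) (hw : GoodWeights (d+1) 3 w) :
    ∃ K : ℝ, 0 < K ∧ ∀ (α γ ρ : Fin d → ℝ) (N : ℝ) (B : ℝ), (∀ i, 0 < ρ i) → 1 ≤ N →
      (∀ F : Finset ((Fin d → ℤ) × ℤ), (0, 0) ∉ F →
        ∑ p ∈ F, (∏ i, ((1 + |(p.1 i : ℝ) / (1 / ρ i)|)⁻¹) ^ 3) *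
          ((1 + |N * ((p.2 : ℝ) - ∑ i, (p.1 i : ℝ) * α i)|)⁻¹) ^ 3 ≤ B) →
      |Dbox d w α γ ρ N| ≤ K * ((∏ i, ρ i) * N * B) := by
  classical
  have hdec : ∀ i, ∃ C : ℝ, 0 < C ∧ ∀ ξ, ‖fhat (w i) ξ‖ ≤ C * ((1 + |ξ|)⁻¹) ^ 3 := fun i =>
    fhat_decay (w i) (hw i).2.1 (hw i).2.2.1
  choose C hC0 hC using hdec
  refine ⟨∏ i, C i, Finset.prod_pos (fun i _ => hC0 i), ?_⟩
  intro α γ ρ N B hρ hN hB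
  have hN0 : 0 < N := by linarith
  have hKp : 0 < ∏ i, C i := Finset.prod_pos (fun i _ => hC0 i)
  set E : ℝ → ℂ := fun t => Complex.exp (2 * Real.pi * Complex.I * t) with hE
  have hEnorm : ∀ t, ‖E t‖ = 1 := by
    intro t
    simp only [hE]
    rw [show (2 * Real.pi * Complex.I * t : ℂ) = ((2 * Real.pi * t : ℝ) : ℂ) * Complex.I by
      push_cast; ring]
    exact Complex.norm_exp_ofReal_mul_I _
  have hEadd : ∀ s t, E (s + t) = E s * E t := by
    intro s t
    simp only [hE]
    rw [← Complex.exp_add]; congr 1; push_cast; ring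
  have hEsum : ∀ (g : Fin d → ℝ), E (∑ i, g i) = ∏ i, E (g i) := by
    intro g
    simp only [hE]
    rw [← Complex.exp_sum]; congr 1; push_cast; rw [Finset.mul_sum]
  -- the dual side
  set c : (Fin d → ℤ) → ℂ := fun m => ∏ i : Fin d, ((ρ i : ℂ) * fhat (w i.castSucc) (ρ i * ((m i : ℝ) - 0)))
    with hc
  set L : (Fin d → ℤ) → ℝ := fun m => ∑ i, (m i : ℝ) * α i with hL
  set G : (Fin d → ℤ) × ℤ → ℂ := fun p => c p.1 * E (-∑ i, (p.1 i : ℝ) * γ i) *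
    ((N : ℂ) * fhat (w (Fin.last d)) (N * ((p.2 : ℝ) - L p.1))) with hG
  have hGnorm : ∀ p, ‖G p‖ ≤ ((∏ i, C i) * ((∏ i, ρ i) * N)) *
      ((∏ i, ((1 + |(p.1 i : ℝ) / (1 / ρ i)|)⁻¹) ^ 3) *
          ((1 + |N * ((p.2 : ℝ) - ∑ i, (p.1 i : ℝ) * α i)|)⁻¹) ^ 3) := by
    intro p
    simp only [hG, hc, norm_mul, hEnorm, mul_one, norm_prod, Complex.norm_real, Real.norm_eq_abs,
      abs_of_pos hN0]
    rw [Fin.prod_univ_castSucc C]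
    have e1 : ∏ i : Fin d, (|ρ i| * ‖fhat (w i.castSucc) (ρ i * ((p.1 i : ℝ) - 0))‖) ≤
        (∏ i : Fin d, C i.castSucc) * (∏ i, ρ i) *
          ∏ i, ((1 + |(p.1 i : ℝ) / (1 / ρ i)|)⁻¹) ^ 3 := by
      rw [← Finset.prod_mul_distrib, ← Finset.prod_mul_distrib]
      apply Finset.prod_le_prod
      · intros; positivity
      · intro i _
        rw [abs_of_pos (hρ i)]
        have := hC i.castSucc (ρ i * ((p.1 i : ℝ) - 0))
        have e : (p.1 i : ℝ) / (1 / ρ i) = ρ i * ((p.1 i : ℝ) - 0) := by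
          rw [sub_zero, div_div_eq_mul_div, div_one, mul_comm]
        rw [e]
        have := mul_le_mul_of_nonneg_left this (hρ i).le
        linarith
    have e2 := mul_le_mul_of_nonneg_left (hC (Fin.last d) (N * ((p.2 : ℝ) - L p.1))) hN0.le
    calc _ ≤ ((∏ i : Fin d, C i.castSucc) * (∏ i, ρ i) *
          ∏ i, ((1 + |(p.1 i : ℝ) / (1 / ρ i)|)⁻¹) ^ 3) *
          (N * (C (Fin.last d) * ((1 + |N * ((p.2 : ℝ) - L p.1)|)⁻¹) ^ 3)) :=
          mul_le_mul e1 e2 (by positivity) (le_trans (Finset.prod_nonneg (fun _ _ => by positivity)) e1)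
      _ = _ := by simp only [hL]; ring
  set A := (∏ i, C i) * ((∏ i, ρ i) * N) with hA
  have hApos : 0 < A := mul_pos hKp (mul_pos (Finset.prod_pos (fun i _ => hρ i)) hN0)
  have hfin : ∀ F : Finset ((Fin d → ℤ) × ℤ), (0, 0) ∉ F → ∑ p ∈ F, ‖G p‖ ≤ A * B := by
    intro F hF
    calc ∑ p ∈ F, ‖G p‖ ≤ ∑ p ∈ F, A * _ := Finset.sum_le_sum (fun p _ => hGnorm p)
      _ = A * _ := by rw [← Finset.mul_sum]
      _ ≤ A * B := by gcongr; exact hB F hF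
  set G' : (Fin d → ℤ) × ℤ → ℂ := fun p => if p = (0, 0) then 0 else G p with hG'
  have hfin' : ∀ F : Finset ((Fin d → ℤ) × ℤ), ∑ p ∈ F, ‖G' p‖ ≤ A * B := by
    intro F
    have : ∑ p ∈ F, ‖G' p‖ = ∑ p ∈ F.erase (0, 0), ‖G p‖ := by
      rw [← Finset.sum_erase F (a := (0, 0)) (by simp [hG'])]
      apply Finset.sum_congr rfl
      intro p hp
      simp only [hG']
      rw [if_neg (Finset.ne_of_mem_erase hp)]
    rw [this]
    exact hfin _ (Finset.notMem_erase _ _)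
  have hG's : Summable (fun p => ‖G' p‖) := summable_of_sum_le (fun _ => norm_nonneg _) hfin'
  have hG'b : ‖∑' p, G' p‖ ≤ A * B :=
    (norm_tsum_le_tsum_norm hG's).trans (hG's.tsum_le_of_sum_le hfin')
  have hGG' : G = fun p => G' p + if p = (0, 0) then G (0, 0) else 0 := by
    ext p
    simp only [hG']
    split_ifs with h
    · rw [h]; simp
    · simp
  have hsing : HasSum (fun p : (Fin d → ℤ) × ℤ => if p = (0, 0) then G (0, 0) else 0) (G (0, 0)) :=
    hasSum_ite_eq _ _
  have hGs : Summable G := by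
    rw [hGG']
    exact hG's.of_norm.add hsing.summable
  have hGt : ∑' p, G p = ∑' p, G' p + G (0, 0) := by
    conv_lhs => rw [hGG']
    rw [Summable.tsum_add hG's.of_norm hsing.summable, hsing.tsum_eq]
  have hG0 : G (0, 0) = ((smoothC w * ((∏ i, ρ i) * N) : ℝ) : ℂ) := by
    have hre : ∀ i, fhat (w i) 0 = (((fhat (w i) 0).re : ℝ) : ℂ) := fun i => by
      apply Complex.ext
      · simp
      · simpa using ((hw i).2.2.2.1 0).1
    simp only [hG, hc, hL, smoothC]
    simp only [Pi.zero_apply, Int.cast_zero, zero_mul, Finset.sum_const_zero, sub_zero, neg_zero,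
      mul_zero]
    rw [Fin.prod_univ_castSucc, Finset.prod_mul_distrib]
    rw [hre (Fin.last d), Finset.prod_congr rfl (fun (i : Fin d) _ => hre i.castSucc)]
    simp only [hE, Complex.ofReal_zero, mul_zero, Complex.exp_zero, Complex.ofReal_re]
    push_cast
    ring
  -- the main identity
  have hmain : ((∑' p : (Fin d → ℤ) × ℤ,
      w (Fin.last d) ((p.2 : ℝ) / N) *
        ∏ i : Fin d, w i.castSucc (((p.1 i : ℝ) + (p.2 : ℝ) * α i - γ i) / ρ i) : ℝ) : ℂ) =
      ∑' p, G p := by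
    have hs : ∀ i, Function.support (w i) ⊆ Set.Icc (-2 : ℝ) 2 := fun i => (hw i).2.1
    have hcd : ∀ i, ContDiff ℝ 3 (w i) := fun i => (hw i).2.2.1
    set F : (Fin d → ℤ) × ℤ → ℂ := fun p => (w (Fin.last d) ((p.2 : ℝ) / N) : ℂ) *
      ∏ i : Fin d, (w i.castSucc ((((p.2 : ℝ) * α i - γ i) + (p.1 i : ℝ)) / ρ i) : ℂ) with hF
    have hlhs : ((∑' p : (Fin d → ℤ) × ℤ,
      w (Fin.last d) ((p.2 : ℝ) / N) *
        ∏ i : Fin d, w i.castSucc (((p.1 i : ℝ) + (p.2 : ℝ) * α i - γ i) / ρ i) : ℝ) : ℂ) =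
        ∑' p, F p := by
      rw [Complex.ofReal_tsum]
      apply tsum_congr
      intro p
      simp only [hF]
      push_cast
      congr 1
      apply Finset.prod_congr rfl
      intro i _
      congr 2
      ring
    have hq : {q : ℤ | w (Fin.last d) ((q : ℝ) / N) ≠ 0}.Finite := by
      simpa using weight_finite (w (Fin.last d)) (hs _) N hN0 0
    have hFs : Summable F := by
      apply summable_of_hasFiniteSupport
      apply (hq.biUnion (t := fun q => (Set.univ.pi (fun i : Fin d =>
        {a : ℤ | w i.castSucc ((((q : ℝ) * α i - γ i) + a) / ρ i) ≠ 0})) ×ˢ {q}) (fun q _ =>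
          (Set.Finite.pi (fun i => weight_finite (w i.castSucc) (hs _) (ρ i) (hρ i) _)).prod
            (Set.finite_singleton q))).subset
      intro p hp
      simp only [hF, Function.mem_support, ne_eq, mul_eq_zero, not_or, Finset.prod_eq_zero_iff,
        not_exists, not_and, Complex.ofReal_eq_zero] at hp
      simp only [Set.mem_iUnion]
      refine ⟨p.2, hp.1, ?_⟩
      simp only [Set.mem_prod, Set.mem_pi, Set.mem_univ, forall_true_left, Set.mem_singleton_iff,
        and_true]
      exact fun i => hp.2 i (Finset.mem_univ _)
    rw [hlhs, ← (Equiv.prodComm ℤ (Fin d → ℤ)).tsum_eq F]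
    have hFs2 : Summable (fun x : ℤ × (Fin d → ℤ) => F ((Equiv.prodComm ℤ (Fin d → ℤ)) x)) :=
      hFs.prod_symm
    rw [Summable.tsum_prod hFs2]
    simp only [Equiv.prodComm_apply, Prod.swap_prod_mk]
    -- inner sums
    have hcsum : ∀ x : Fin d → ℝ, Summable (fun m : Fin d → ℤ => ‖∏ i : Fin d,
        (((ρ i : ℂ) * fhat (w i.castSucc) (ρ i * ((m i : ℝ) - 0))) * E ((m i : ℝ) * x i))‖) ∧
        ∑' m : Fin d → ℤ, ∏ i : Fin d,
        (((ρ i : ℂ) * fhat (w i.castSucc) (ρ i * ((m i : ℝ) - 0))) * E ((m i : ℝ) * x i)) =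
        ∏ i : Fin d, ∑' a : ℤ,
        (((ρ i : ℂ) * fhat (w i.castSucc) (ρ i * ((a : ℝ) - 0))) * E ((a : ℝ) * x i)) := by
      intro x
      apply tsum_pi_prod d (fun i a => (((ρ i : ℂ) * fhat (w i.castSucc) (ρ i * ((a : ℝ) - 0))) *
        E ((a : ℝ) * x i)))
      intro i
      simp only [norm_mul _ (E _), hEnorm, mul_one]
      exact decay_summable (w i.castSucc) (C i.castSucc) (hC _) (ρ i) 0 (hρ i)
    have hprodE : ∀ (q : ℝ) (m : Fin d → ℤ), ∏ i : Fin d,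
        (((ρ i : ℂ) * fhat (w i.castSucc) (ρ i * ((m i : ℝ) - 0))) *
          E ((m i : ℝ) * (q * α i - γ i))) =
        c m * E (-∑ i, (m i : ℝ) * γ i) * E (L m * q) := by
      intro q m
      rw [Finset.prod_mul_distrib, ← hEsum, mul_assoc, ← hEadd]
      congr 2
      simp only [hL]
      rw [Finset.sum_mul, ← Finset.sum_neg_distrib, ← Finset.sum_add_distrib]
      apply Finset.sum_congr rfl
      intro i _
      ring
    have hTs : ∀ q : ℤ, Summable (fun m : Fin d → ℤ => (w (Fin.last d) ((q : ℝ) / N) : ℂ) *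
        (c m * E (-∑ i, (m i : ℝ) * γ i) * E (L m * q))) := by
      intro q
      apply Summable.mul_left
      have := (hcsum (fun i => (q : ℝ) * α i - γ i)).1.of_norm
      simpa only [hprodE] using this
    have hinner : ∀ q : ℤ, ∑' a : Fin d → ℤ, F (a, q) = ∑' m : Fin d → ℤ,
        (w (Fin.last d) ((q : ℝ) / N) : ℂ) *
          (c m * E (-∑ i, (m i : ℝ) * γ i) * E (L m * q)) := by
      intro q
      rw [tsum_mul_left]
      simp only [hF]
      rw [tsum_mul_left]
      congr 1
      rw [(tsum_pi_prod d (fun i a => (w i.castSucc ((((q : ℝ) * α i - γ i) + (a : ℝ)) / ρ i) : ℂ))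
        ?_).2]
      · simp only [← hprodE]
        rw [(hcsum (fun i => (q : ℝ) * α i - γ i)).2]
        apply Finset.prod_congr rfl
        intro i _
        have := poisson1 (w i.castSucc) (hs _) (hcd _) (ρ i) 0 ((q : ℝ) * α i - γ i) (hρ i)
        simp only [Complex.ofReal_zero, mul_zero, zero_mul, Complex.exp_zero, mul_one] at this
        rw [this]
        apply tsum_congr
        intro n
        congr 1
        simp only [hE]
        congr 1
        push_cast
        ring
      · intro i
        apply summable_of_hasFiniteSupport
        apply (weight_finite (w i.castSucc) (hs _) (ρ i) (hρ i) ((q : ℝ) * α i - γ i)).subset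
        intro a ha
        simpa using ha
    rw [tsum_congr hinner]
    rw [tsum_eq_sum (s := hq.toFinset) (by
      intro q hqn
      have : w (Fin.last d) ((q : ℝ) / N) = 0 := by
        by_contra h
        exact hqn (by simpa using h)
      simp [this])]
    rw [← Summable.tsum_finsetSum (fun q _ => hTs q)]
    rw [Summable.tsum_prod hGs]
    apply tsum_congr
    intro m
    have hp := poisson1 (w (Fin.last d)) (hs _) (hcd _) N (L m) 0 hN0
    simp only [Complex.ofReal_zero, mul_zero, zero_add, Complex.exp_zero, mul_one] at hp
    simp only [hG]
    rw [tsum_mul_left, ← hp]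
    rw [tsum_eq_sum (s := hq.toFinset) (by
      intro q hqn
      have : w (Fin.last d) ((q : ℝ) / N) = 0 := by
        by_contra h
        exact hqn (by simpa using h)
      simp [this])]
    rw [Finset.mul_sum]
    apply Finset.sum_congr rfl
    intro q _
    simp only [hE]
    push_cast
    rw [show (2 * (Real.pi : ℂ) * Complex.I * (((L m : ℝ) : ℂ) * (q : ℂ))) =
      2 * Real.pi * Complex.I * (L m : ℂ) * q by ring]
    ring
  have hD : ((Dbox d w α γ ρ N : ℝ) : ℂ) = ∑' p, G' p := by
    unfold Dbox
    rw [Complex.ofReal_sub, hmain, hGt, hG0]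
    ring
  have : |Dbox d w α γ ρ N| = ‖((Dbox d w α γ ρ N : ℝ) : ℂ)‖ := by
    rw [Complex.norm_real, Real.norm_eq_abs]
  rw [this, hD]
  refine hG'b.trans (le_of_eq ?_)
  rw [hA]; ring

/-- dyadic shape of an integer vector -/
def szv {d : ℕ} (m : Fin d → ℤ) : Fin d → ℕ := fun i => (m i).natAbs.size

/-- sum of a shape -/
def JJ {d : ℕ} (a : Fin d → ℕ) : ℕ := ∑ i, a i

/-- maximum of a shape -/
def XX {d : ℕ} (a : Fin d → ℕ) : ℕ := Finset.univ.sup a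

/-- scale of a shape -/
def SS {d : ℕ} (a : Fin d → ℕ) : ℕ := JJ a + XX a

lemma le_XX {d : ℕ} (a : Fin d → ℕ) (i : Fin d) : a i ≤ XX a := Finset.le_sup (f := a) (Finset.mem_univ i)

lemma szv_lt {d : ℕ} (m : Fin d → ℤ) (i : Fin d) : |(m i : ℝ)| < 2 ^ (szv m i) := by
  have h : (m i).natAbs < 2 ^ (szv m i) := Nat.lt_size_self _
  have h2 : |(m i : ℝ)| = ((m i).natAbs : ℝ) := by rw [Nat.cast_natAbs]; simp
  rw [h2]; exact_mod_cast h

lemma szv_le {d : ℕ} (m : Fin d → ℤ) (i : Fin d) (c : ℕ) (h : |m i| < 2 ^ c) : szv m i ≤ c := by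
  unfold szv
  rw [Nat.size_le]
  have : ((m i).natAbs : ℤ) < ((2 ^ c : ℕ) : ℤ) := by
    rw [Int.natCast_natAbs]; exact_mod_cast h
  exact_mod_cast this

lemma exists_sum_eq {d : ℕ} (b : Fin d → ℕ) (e : ℕ) (h : e ≤ ∑ i, b i) :
    ∃ c : Fin d → ℕ, (∀ i, c i ≤ b i) ∧ ∑ i, c i = e := by
  classical
  induction e with
  | zero => exact ⟨0, fun i => Nat.zero_le _, by simp⟩
  | succ e ih =>
    obtain ⟨c, hc, hs⟩ := ih (by omega)
    have : ∃ i, c i < b i := by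
      by_contra hcon
      push Not at hcon
      have : ∑ i, b i ≤ ∑ i, c i := Finset.sum_le_sum (fun i _ => hcon i)
      omega
    obtain ⟨i, hi⟩ := this
    refine ⟨Function.update c i (c i + 1), ?_, ?_⟩
    · intro k
      by_cases hk : k = i
      · subst hk; simp; omega
      · simp [Function.update_of_ne hk, hc k]
    · have h1 : ∑ k, Function.update c i (c i + 1) k = ∑ k, (c k + if k = i then 1 else 0) := by
        apply Finset.sum_congr rfl
        intro k _
        by_cases hk : k = i
        · subst hk; simp
        · simp [Function.update_of_ne hk, hk]
      rw [h1, Finset.sum_add_distrib, hs]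
      simp

lemma transfer (d : ℕ) (x : Fin d → ℝ) (ℓ p t : ℕ) (a : Fin d → ℕ)
    (hℓ : XX a + t ≤ ℓ) (ht : 1 ≤ t) (hS : ℓ + d * (p + 2 * d) ≤ SS a)
    (hgood : ∀ m : Fin d → ℤ, m ≠ 0 → SS (szv m) + p < ℓ → ∀ n : ℤ,
      1 / (2 : ℝ) ^ (JJ (szv m) + p) ≤ |∑ i, (m i : ℝ) * x i - n|)
    (q : ℕ) (hq1 : 1 ≤ q) (hq : q < 2 ^ (ℓ - XX a - t)) :
    ∃ i, ∀ n : ℤ, 1 / ((2 ^ a i : ℕ) : ℝ) ≤ |q * x i - n| := by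
  classical
  by_contra hcon
  push Not at hcon
  choose n hn using hcon
  set g := p + 2 * d with hg
  set b : Fin d → ℕ := fun i => a i - g with hb
  set e := Nat.size q with he
  have he1 : e ≤ ℓ - XX a - t := Nat.size_le.mpr hq
  have he0 : 1 ≤ e := Nat.size_pos.mpr hq1
  have hqe : q < 2 ^ e := Nat.lt_size_self q
  have hqe2 : 2 ^ (e - 1) ≤ q := Nat.lt_size.mp (by omega)
  have hbs : e ≤ ∑ i, b i := by
    have h1 : ∑ i, a i ≤ ∑ i, (b i + g) := Finset.sum_le_sum (fun i _ => by simp only [hb]; omega)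
    rw [Finset.sum_add_distrib] at h1
    simp only [Finset.sum_const, Finset.card_univ, Fintype.card_fin, smul_eq_mul] at h1
    unfold SS JJ at hS
    omega
  obtain ⟨c, hcb, hcs⟩ := exists_sum_eq b e hbs
  -- pigeonhole
  set P : Finset (Fin d → ℕ) := Fintype.piFinset (fun i => Finset.range (2 ^ c i)) with hP
  have hPc : P.card = 2 ^ e := by
    rw [hP, Fintype.card_piFinset]; simp [Finset.prod_pow_eq_pow_sum, hcs]
  let f : (Fin d → ℕ) → ℤ := fun u => (∑ i, (u i : ℤ) * n i) % q
  have hq0 : (0 : ℤ) < q := by exact_mod_cast hq1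
  have hmaps : ∀ u ∈ P, f u ∈ Finset.Ico (0 : ℤ) q := by
    intro u _
    rw [Finset.mem_Ico]
    exact ⟨Int.emod_nonneg _ hq0.ne', Int.emod_lt_of_pos _ hq0⟩
  obtain ⟨u, hu, v, hv, huv, hfuv⟩ := Finset.exists_ne_map_eq_of_card_lt_of_maps_to
    (by rw [hPc]; simpa using hqe) hmaps
  have hu' : ∀ i, u i < 2 ^ c i := by simpa [hP] using hu
  have hv' : ∀ i, v i < 2 ^ c i := by simpa [hP] using hv
  set m : Fin d → ℤ := fun i => (u i : ℤ) - v i with hm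
  have hm0 : m ≠ 0 := by
    intro h
    apply huv
    ext i
    have := congrFun h i
    simp only [hm, Pi.zero_apply] at this
    omega
  have hmc : ∀ i, |m i| < 2 ^ c i := by
    intro i
    have h1 : (u i : ℤ) < 2 ^ c i := by exact_mod_cast hu' i
    have h2 : (v i : ℤ) < 2 ^ c i := by exact_mod_cast hv' i
    rw [abs_lt]; simp only [hm]; constructor <;> omega
  have hdvd : (q : ℤ) ∣ ∑ i, m i * n i := by
    have : ∑ i, m i * n i = ∑ i, (u i : ℤ) * n i - ∑ i, (v i : ℤ) * n i := by
      rw [← Finset.sum_sub_distrib]; apply Finset.sum_congr rfl; intro i _; simp only [hm]; ring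
    rw [this]
    exact Int.dvd_of_emod_eq_zero (Int.emod_eq_emod_iff_emod_sub_eq_zero.mp hfuv)
  obtain ⟨n', hn'⟩ := hdvd
  have hsz : ∀ i, szv m i ≤ c i := fun i => szv_le m i _ (hmc i)
  have hJ : JJ (szv m) ≤ e := by
    unfold JJ; rw [← hcs]; exact Finset.sum_le_sum (fun i _ => hsz i)
  have hX : XX (szv m) ≤ XX a - g := by
    unfold XX
    apply Finset.sup_le
    intro i _
    have := le_XX a i
    have := hsz i
    have := hcb i
    simp only [hb, XX] at *
    omega
  have hXg : g < XX a := by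
    by_contra h
    have : ∀ i, c i = 0 := by
      intro i
      have := le_XX a i
      have := hcb i
      simp only [hb] at *
      omega
    rw [Finset.sum_eq_zero (fun i _ => this i)] at hcs
    omega
  have hlow := hgood m hm0 (by unfold SS; omega) n'
  have hqr : (0 : ℝ) < q := by exact_mod_cast hq1
  have hup : (q : ℝ) * |∑ i, (m i : ℝ) * x i - n'| ≤ d * (1 / 2 ^ g) := by
    have e1 : (q : ℝ) * (∑ i, (m i : ℝ) * x i - n') = ∑ i, (m i : ℝ) * (q * x i - n i) := by
      have : (q : ℝ) * n' = ∑ i, (m i : ℝ) * n i := by exact_mod_cast hn'.symm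
      rw [mul_sub, this, Finset.mul_sum, ← Finset.sum_sub_distrib]
      apply Finset.sum_congr rfl; intro i _; ring
    rw [← Nat.abs_cast q, ← abs_mul, e1]
    calc _ ≤ ∑ i, |(m i : ℝ) * (q * x i - n i)| := Finset.abs_sum_le_sum_abs _ _
      _ ≤ ∑ i : Fin d, 1 / (2 : ℝ) ^ g := by
          apply Finset.sum_le_sum
          intro i _
          rw [abs_mul]
          rcases Nat.eq_zero_or_pos (c i) with h | h
          · have := hmc i
            rw [h, pow_zero, Int.abs_lt_one_iff] at this
            rw [this]; simp
          · have h1 : c i + g ≤ a i := by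
              have := hcb i
              simp only [hb] at this
              omega
            have h2 : |(m i : ℝ)| ≤ 2 ^ c i := by exact_mod_cast (hmc i).le
            have h3 := (hn i).le
            calc |(m i : ℝ)| * |(q : ℝ) * x i - n i| ≤ 2 ^ c i * (1 / ((2 ^ a i : ℕ) : ℝ)) := by gcongr
              _ ≤ 1 / 2 ^ g := by
                push_cast
                rw [mul_one_div, div_le_div_iff₀ (by positivity) (by positivity), ← pow_add, one_mul]
                exact pow_le_pow_right₀ (by norm_num) h1
      _ = _ := by simp
  have hq2 : (2 : ℝ) ^ e ≤ 2 * q := by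
    have : 2 ^ e ≤ 2 * q := by
      calc 2 ^ e = 2 * 2 ^ (e - 1) := by rw [← pow_succ']; congr 1; omega
        _ ≤ 2 * q := by omega
    exact_mod_cast this
  have hlow2 : 1 / (2 : ℝ) ^ (e + p) ≤ |∑ i, (m i : ℝ) * x i - n'| := by
    refine le_trans ?_ hlow
    apply one_div_le_one_div_of_le (by positivity)
    exact pow_le_pow_right₀ (by norm_num) (by omega)
  have h5 : (q : ℝ) * (1 / (2 : ℝ) ^ (e + p)) ≤ d * (1 / 2 ^ g) :=
    le_trans (by gcongr) hup
  rw [mul_one_div, mul_one_div, div_le_div_iff₀ (by positivity) (by positivity), hg, pow_add, pow_add,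
    ] at h5
  have h6 : (2 : ℝ) ^ (2 * d) ≤ 2 * d := by
    have hpp : (0 : ℝ) < 2 ^ p := by positivity
    have : (q : ℝ) * 2 ^ (2 * d) ≤ d * 2 ^ e := by
      have : ((q : ℝ) * 2 ^ (2 * d)) * 2 ^ p ≤ (d * 2 ^ e) * 2 ^ p := by linarith
      exact le_of_mul_le_mul_right this hpp
    have : (q : ℝ) * 2 ^ (2 * d) ≤ q * (2 * d) := by
      refine this.trans ?_
      have : (d : ℝ) * 2 ^ e ≤ d * (2 * q) := by gcongr
      linarith
    exact le_of_mul_le_mul_left this hqr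
  have h7 : 2 ^ (2 * d) ≤ 2 * d := by exact_mod_cast h6
  have := Nat.lt_two_pow_self (n := 2 * d)
  omega

lemma int_count (G : Finset ℤ) (y η : ℝ) (hη : 0 ≤ η) (hG : ∀ n ∈ G, |y - n| ≤ η) :
    (G.card : ℝ) ≤ 2 * η + 1 := by
  have hsub : G ⊆ Finset.Icc ⌈y - η⌉ ⌊y + η⌋ := by
    intro n hn
    have := abs_le.mp (hG n hn)
    rw [Finset.mem_Icc]
    constructor
    · rw [Int.ceil_le]; linarith
    · rw [Int.le_floor]; linarith
  have h1 := Finset.card_le_card hsub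
  rw [Int.card_Icc] at h1
  have h2 : (G.card : ℝ) ≤ ((⌊y + η⌋ + 1 - ⌈y - η⌉).toNat : ℝ) := by exact_mod_cast h1
  refine h2.trans ?_
  have h3 : (⌊y + η⌋ : ℝ) ≤ y + η := Int.floor_le _
  have h4 : y - η ≤ (⌈y - η⌉ : ℝ) := Int.le_ceil _
  rcases le_total 0 (⌊y + η⌋ + 1 - ⌈y - η⌉) with h | h
  · have : (((⌊y + η⌋ + 1 - ⌈y - η⌉).toNat : ℤ) : ℝ) = ((⌊y + η⌋ + 1 - ⌈y - η⌉ : ℤ) : ℝ) := by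
      rw [Int.toNat_of_nonneg h]
    have h6 : ((⌊y + η⌋ + 1 - ⌈y - η⌉).toNat : ℝ) = ((⌊y + η⌋ + 1 - ⌈y - η⌉ : ℤ) : ℝ) := by
      rw [← this]; norm_cast
    rw [h6]; push_cast; linarith
  · rw [Int.toNat_of_nonpos h]; push_cast; linarith

/-- constant in the strip counting lemma -/
noncomputable def K2c (d : ℕ) : ℝ := 3 ^ d * (3 * 2 ^ (d + 4) + 2 * d) + 8 * 80 ^ d * 2 ^ (d + 4)

lemma six_le (d : ℕ) : 6 * (d + 1) ≤ 2 ^ (d + 4) := by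
  induction d with
  | zero => norm_num
  | succ n ih => rw [show n + 1 + 4 = (n + 4) + 1 by ring, pow_succ]; omega

lemma shape_count (d : ℕ) (x : Fin d → ℝ) (ℓ p : ℕ) (a : Fin d → ℕ)
    (hS : ℓ = 0 ∨ ℓ + d * (p + 2 * d) ≤ SS a)
    (hgood : ∀ m : Fin d → ℤ, m ≠ 0 → SS (szv m) + p < ℓ → ∀ n : ℤ,
      1 / (2 : ℝ) ^ (JJ (szv m) + p) ≤ |∑ i, (m i : ℝ) * x i - n|)
    (F : Finset ((Fin d → ℤ) × ℤ))
    (hF : ∀ r ∈ F, szv r.1 = a ∧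
      |∑ i, (r.1 i : ℝ) * x i - r.2| < 1 / 2 ^ (JJ a) + d * 2 ^ (XX a) / 2 ^ ℓ) :
    (F.card : ℝ) ≤ K2c d * (2 ^ (SS a) / 2 ^ ℓ) := by
  classical
  set t := d + 4 with ht
  set η : ℝ := 1 / 2 ^ (JJ a) + d * 2 ^ (XX a) / 2 ^ ℓ with hη
  have hη0 : 0 ≤ η := by positivity
  set I := F.image Prod.fst with hI
  have hcard : (F.card : ℝ) ≤ I.card * (2 * η + 1) := by
    rw [Finset.card_eq_sum_card_image Prod.fst F]
    push_cast
    calc _ ≤ ∑ m ∈ I, (2 * η + 1) := by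
          apply Finset.sum_le_sum
          intro m _
          have hinj : Set.InjOn Prod.snd ((F.filter (fun r => r.1 = m) : Finset _) : Set ((Fin d → ℤ) × ℤ)) := by
            rintro ⟨r1, r2⟩ h1 ⟨r3, r4⟩ h2 h
            simp only [Finset.coe_filter, Set.mem_setOf_eq] at h1 h2
            simp only at h
            rw [h, h1.2, h2.2]
          rw [← Finset.card_image_of_injOn hinj]
          apply int_count _ (∑ i, (m i : ℝ) * x i) η hη0
          intro n hn
          obtain ⟨r, hr, rfl⟩ := Finset.mem_image.mp hn
          rw [Finset.mem_filter] at hr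
          have := (hF r hr.1).2.le
          rw [hr.2] at this
          exact this
      _ = _ := by rw [Finset.sum_const, nsmul_eq_mul]
  have hIm : ∀ m ∈ I, szv m = a := by
    intro m hm
    obtain ⟨r, hr, rfl⟩ := Finset.mem_image.mp hm
    exact (hF r hr).1
  have hIb : ∀ m ∈ I, ∀ i, |m i| ≤ ((2 ^ a i : ℕ) : ℤ) := by
    intro m hm i
    have h := (szv_lt m i).le
    rw [hIm m hm] at h
    exact_mod_cast h
  have hprod : (∏ i, (((2 ^ a i : ℕ) : ℕ) : ℝ)) = 2 ^ JJ a := by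
    push_cast; rw [Finset.prod_pow_eq_pow_sum]; rfl
  have hSS : (2 : ℝ) ^ SS a = 2 ^ JJ a * 2 ^ XX a := by unfold SS; rw [pow_add]
  have hJ1 : 1 / (2 : ℝ) ^ (JJ a) ≤ 1 := by
    rw [div_le_one (by positivity)]; exact one_le_pow₀ (by norm_num)
  set Y : ℝ := 2 ^ XX a / 2 ^ ℓ with hY
  have hYpos : 0 < Y := by positivity
  have hηY : η = 1 / 2 ^ (JJ a) + d * Y := by rw [hη, hY]; ring
  have hgoal : 2 ^ SS a / (2 : ℝ) ^ ℓ = 2 ^ JJ a * Y := by rw [hSS, hY]; ring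
  rw [hgoal]
  have hJp : (0 : ℝ) < 2 ^ JJ a := by positivity
  have h6 : (6 : ℝ) * (d + 1) ≤ 2 ^ t := by exact_mod_cast six_le d
  rcases le_or_gt ℓ (XX a + t) with hc | hc
  · -- trivial count
    have hIc : (I.card : ℝ) ≤ 3 ^ d * 2 ^ JJ a := by
      have hsub : I ⊆ Fintype.piFinset (fun i => Finset.Icc (-((2 ^ a i : ℕ) : ℤ)) ((2 ^ a i : ℕ) : ℤ)) := by
        intro m hm
        rw [Fintype.mem_piFinset]
        intro i
        rw [Finset.mem_Icc]
        exact abs_le.mp (hIb m hm i)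
      have h1 := Finset.card_le_card hsub
      rw [Fintype.card_piFinset] at h1
      have h2 : (I.card : ℝ) ≤ ∏ i, ((Finset.Icc (-((2 ^ a i : ℕ) : ℤ)) ((2 ^ a i : ℕ) : ℤ)).card : ℝ) := by
        exact_mod_cast h1
      refine h2.trans ?_
      calc _ ≤ ∏ i, (3 * ((2 ^ a i : ℕ) : ℝ)) := by
            apply Finset.prod_le_prod (fun _ _ => by positivity)
            intro i _
            have h3 : (Finset.Icc (-((2 ^ a i : ℕ) : ℤ)) ((2 ^ a i : ℕ) : ℤ)).card ≤ 3 * 2 ^ a i := by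
              rw [Int.card_Icc]
              have : 1 ≤ 2 ^ a i := Nat.one_le_two_pow
              omega
            exact_mod_cast h3
        _ = _ := by rw [Finset.prod_mul_distrib, hprod]; simp
    have hYt : 1 ≤ 2 ^ t * Y := by
      rw [hY, ← mul_div_assoc, le_div_iff₀ (by positivity), one_mul, ← pow_add]
      exact pow_le_pow_right₀ (by norm_num) (by omega)
    have h2 : 2 * η + 1 ≤ (3 * 2 ^ t + 2 * d) * Y := by
      rw [hηY]; linarith
    calc (F.card : ℝ) ≤ I.card * (2 * η + 1) := hcard
      _ ≤ (3 ^ d * 2 ^ JJ a) * ((3 * 2 ^ t + 2 * d) * Y) := by gcongr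
      _ = (3 ^ d * (3 * 2 ^ t + 2 * d)) * (2 ^ JJ a * Y) := by ring
      _ ≤ K2c d * (2 ^ JJ a * Y) := by
          apply mul_le_mul_of_nonneg_right _ (by positivity)
          unfold K2c
          have : (0 : ℝ) ≤ 8 * 80 ^ d * 2 ^ (d + 4) := by positivity
          linarith
  · have hS' : ℓ + d * (p + 2 * d) ≤ SS a := by
      rcases hS with h | h
      · omega
      · exact h
    have hJY : 1 / (2 : ℝ) ^ (JJ a) ≤ Y := by
      rw [hY, div_le_div_iff₀ (by positivity) (by positivity), one_mul, ← pow_add]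
      apply pow_le_pow_right₀ (by norm_num)
      unfold SS at hS'
      omega
    have hηb : η ≤ (d + 1) * Y := by rw [hηY]; linarith
    set Qn : ℕ := 2 ^ (ℓ - XX a - t) with hQn
    have hQY : (Qn : ℝ) * Y * 2 ^ t = 1 := by
      rw [hQn, hY]; push_cast
      have : (2 : ℝ) ^ ℓ = 2 ^ (ℓ - XX a - t) * 2 ^ XX a * 2 ^ t := by
        rw [← pow_add, ← pow_add]; congr 1; omega
      rw [this]
      field_simp
    have hQ1 : 1 ≤ Qn := Nat.one_le_two_pow
    have hQ1' : (1 : ℝ) ≤ Qn := by exact_mod_cast hQ1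
    have hQη : (Qn : ℝ) * η ≤ 1 / 6 := by
      have : (Qn : ℝ) * η ≤ (d + 1) * (Qn * Y) := by
        calc (Qn : ℝ) * η ≤ Qn * ((d + 1) * Y) := by gcongr
          _ = _ := by ring
      have h3 : 6 * (d + 1) * (Qn * Y) ≤ 2 ^ t * (Qn * Y) := by gcongr
      linarith
    have hηs : η ≤ 1 / 6 := le_trans (by nlinarith) hQη
    have hls := large_sieve d x (fun i => 2 ^ a i) (fun i => Nat.one_le_two_pow) Qn hQ1
      (fun q hq1 hq => transfer d x ℓ p t a (by omega) (by omega) hS' hgood q hq1 hq) I (by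
        intro m hm
        refine ⟨hIb m hm, ?_⟩
        obtain ⟨r, hr, rfl⟩ := Finset.mem_image.mp hm
        refine ⟨r.2, le_trans ?_ hQη⟩
        gcongr
        exact (hF r hr).2.le)
    rw [hprod] at hls
    have hIc : (I.card : ℝ) ≤ 4 * 80 ^ d * 2 ^ JJ a * (2 ^ t * Y) := by
      calc (I.card : ℝ) = (I.card * Qn) * (2 ^ t * Y) := by
            rw [mul_assoc, show (Qn : ℝ) * (2 ^ t * Y) = Qn * Y * 2 ^ t by ring, hQY, mul_one]
        _ ≤ _ := by gcongr
    calc (F.card : ℝ) ≤ I.card * (2 * η + 1) := hcard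
      _ ≤ (4 * 80 ^ d * 2 ^ JJ a * (2 ^ t * Y)) * 2 := by gcongr; linarith
      _ = (8 * 80 ^ d * 2 ^ t) * (2 ^ JJ a * Y) := by ring
      _ ≤ K2c d * (2 ^ JJ a * Y) := by
          apply mul_le_mul_of_nonneg_right _ (by positivity)
          unfold K2c
          have : (0 : ℝ) ≤ 3 ^ d * (3 * 2 ^ (d + 4) + 2 * d) := by positivity
          linarith

/-- the strip `r` of parameter `p` meets the cube of side `2^{-ℓ}` at `x` -/
def HitP {d : ℕ} (p : ℕ) (x : Fin d → ℝ) (ℓ : ℕ) (r : (Fin d → ℤ) × ℤ) : Prop :=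
  |∑ i, (r.1 i : ℝ) * x i - r.2| < 1 / 2 ^ (JJ (szv r.1) + p) + d * 2 ^ (XX (szv r.1)) / 2 ^ ℓ

/-- corner of a child cube -/
noncomputable def chd {d : ℕ} (x : Fin d → ℝ) (ℓ : ℕ) (u : Fin d → ℕ) : Fin d → ℝ :=
  fun i => x i + (u i : ℝ) / 2 ^ ℓ

lemma lin_diff {d : ℕ} (m : Fin d → ℤ) (x y : Fin d → ℝ) (ε : ℝ) (h : ∀ i, |x i - y i| ≤ ε) (n : ℤ) :
    |∑ i, (m i : ℝ) * x i - n| ≤ |∑ i, (m i : ℝ) * y i - n| + d * 2 ^ (XX (szv m)) * ε := by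
  have e : ∑ i, (m i : ℝ) * x i - n = (∑ i, (m i : ℝ) * y i - n) + ∑ i, (m i : ℝ) * (x i - y i) := by
    simp only [mul_sub, Finset.sum_sub_distrib]; ring
  rw [e]
  refine (abs_add_le _ _).trans ?_
  gcongr
  calc _ ≤ ∑ i, |(m i : ℝ) * (x i - y i)| := Finset.abs_sum_le_sum_abs _ _
    _ ≤ ∑ i : Fin d, 2 ^ (XX (szv m)) * ε := by
        apply Finset.sum_le_sum
        intro i _
        rw [abs_mul]
        have h1 : |(m i : ℝ)| ≤ 2 ^ (XX (szv m)) :=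
          (szv_lt m i).le.trans (pow_le_pow_right₀ (by norm_num) (le_XX _ i))
        exact mul_le_mul h1 (h i) (abs_nonneg _) (by positivity)
    _ = _ := by simp [mul_assoc]

lemma chd_diff {d : ℕ} (x : Fin d → ℝ) (ℓ h : ℕ) (u : Fin d → ℕ) (hu : ∀ i, u i < 2 ^ h) (i : Fin d) :
    0 ≤ chd x (ℓ + h) u i - x i ∧ chd x (ℓ + h) u i - x i ≤ 1 / 2 ^ ℓ - 1 / 2 ^ (ℓ + h) := by
  unfold chd
  constructor
  · have : (0 : ℝ) ≤ (u i : ℝ) / 2 ^ (ℓ + h) := by positivity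
    linarith
  · have h1 : (u i : ℝ) + 1 ≤ 2 ^ h := by exact_mod_cast hu i
    have e : (1 : ℝ) / 2 ^ ℓ = 2 ^ h / 2 ^ (ℓ + h) := by rw [pow_add]; field_simp
    rw [e, ← sub_div, add_sub_cancel_left]
    gcongr
    linarith

lemma hit_parent {d : ℕ} (p : ℕ) (x : Fin d → ℝ) (ℓ h : ℕ) (u : Fin d → ℕ) (hu : ∀ i, u i < 2 ^ h)
    (r : (Fin d → ℤ) × ℤ) (hr : HitP p (chd x (ℓ + h) u) (ℓ + h) r) : HitP p x ℓ r := by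
  unfold HitP at *
  have h1 := lin_diff r.1 x (chd x (ℓ + h) u) (1 / 2 ^ ℓ - 1 / 2 ^ (ℓ + h)) (fun i => by
    have := chd_diff x ℓ h u hu i
    rw [abs_sub_comm, abs_of_nonneg this.1]; exact this.2) r.2
  have e : (d : ℝ) * 2 ^ XX (szv r.1) * (1 / 2 ^ ℓ - 1 / 2 ^ (ℓ + h)) =
    d * 2 ^ XX (szv r.1) / 2 ^ ℓ - d * 2 ^ XX (szv r.1) / 2 ^ (ℓ + h) := by ring
  rw [e] at h1
  linarith

lemma XX_attained {d : ℕ} (m : Fin d → ℤ) (hm : m ≠ 0) :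
    ∃ i, szv m i = XX (szv m) ∧ (2 : ℝ) ^ XX (szv m) ≤ 2 * |(m i : ℝ)| := by
  have hne : ∃ i, m i ≠ 0 := by
    by_contra h; push Not at h; exact hm (funext h)
  obtain ⟨k, hk⟩ := hne
  obtain ⟨i, _, hi⟩ := Finset.exists_mem_eq_sup (Finset.univ : Finset (Fin d)) ⟨k, Finset.mem_univ _⟩ (szv m)
  refine ⟨i, hi.symm, ?_⟩
  have hi' : XX (szv m) = szv m i := hi
  rw [hi']
  have hpos : 1 ≤ szv m i := by
    rw [← hi']
    refine le_trans ?_ (le_XX _ k)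
    unfold szv
    exact Nat.size_pos.mpr (Int.natAbs_pos.mpr hk)
  have h1 : 2 ^ (szv m i - 1) ≤ (m i).natAbs := Nat.lt_size.mp (by unfold szv at *; omega)
  have h2 : 2 ^ szv m i ≤ 2 * (m i).natAbs := by
    calc 2 ^ szv m i = 2 * 2 ^ (szv m i - 1) := by rw [← pow_succ']; congr 1; omega
      _ ≤ _ := by omega
  have h3 : |(m i : ℝ)| = ((m i).natAbs : ℝ) := by rw [Nat.cast_natAbs]; simp
  rw [h3]; exact_mod_cast h2

open Classical in
lemma child_count (d : ℕ) (x : Fin d → ℝ) (L h p : ℕ) (r : (Fin d → ℤ) × ℤ) (hr : r.1 ≠ 0) :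
    (((Fintype.piFinset (fun _ : Fin d => Finset.range (2 ^ h))).filter
      (fun u => HitP p (chd x L u) L r)).card : ℝ) ≤
      (2 ^ h) ^ (d - 1) * (4 * (2 ^ L / 2 ^ (SS (szv r.1) + p)) + (4 * d + 1)) := by
  obtain ⟨i, hi, hmi⟩ := XX_attained r.1 hr
  set U := Fintype.piFinset (fun _ : Fin d => Finset.range (2 ^ h)) with hU
  set G := U.filter (fun u => HitP p (chd x L u) L r) with hG
  set R : ℝ := 1 / 2 ^ (JJ (szv r.1) + p) + d * 2 ^ (XX (szv r.1)) / 2 ^ L with hR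
  have hXpos : (0 : ℝ) < 2 ^ XX (szv r.1) := by positivity
  have hmpos : 0 < |(r.1 i : ℝ)| := by linarith
  have hm0 : (r.1 i : ℝ) ≠ 0 := abs_pos.mp hmpos
  set η : ℝ := R * 2 ^ L / |(r.1 i : ℝ)| with hη
  have hη0 : 0 ≤ η := by positivity
  have hηb : 2 * η + 1 ≤ 4 * (2 ^ L / 2 ^ (SS (szv r.1) + p)) + (4 * d + 1) := by
    have h1 : η ≤ 2 * (R * 2 ^ L / 2 ^ XX (szv r.1)) := by
      rw [hη, ← mul_div_assoc, div_le_div_iff₀ hmpos hXpos]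
      have : 0 ≤ R * 2 ^ L := by positivity
      nlinarith
    have h2 : R * 2 ^ L / 2 ^ XX (szv r.1) = 2 ^ L / 2 ^ (SS (szv r.1) + p) + d := by
      rw [hR]; unfold SS
      rw [pow_add, pow_add, pow_add]
      field_simp
    rw [h2] at h1
    linarith
  let f : (Fin d → ℕ) → (Fin d → ℕ) := fun u => Function.update u i 0
  have himg : ((G.image f).card : ℝ) ≤ (2 ^ h) ^ (d - 1) := by
    have hsub : G.image f ⊆ Fintype.piFinset (fun k => if k = i then {0} else Finset.range (2 ^ h)) := by
      intro v hv
      obtain ⟨u, hu, rfl⟩ := Finset.mem_image.mp hv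
      have hu1 : ∀ k, u k < 2 ^ h := by
        have := (Finset.mem_filter.mp hu).1
        simpa [hU] using this
      rw [Fintype.mem_piFinset]
      intro k
      by_cases hk : k = i
      · subst hk; simp [f]
      · simp [f, hk, hu1 k]
    have h1 := Finset.card_le_card hsub
    have h2 : (Fintype.piFinset (fun k => if k = i then {0} else Finset.range (2 ^ h))).card =
        (2 ^ h) ^ (d - 1) := by
      rw [Fintype.card_piFinset, ← Finset.mul_prod_erase _ _ (Finset.mem_univ i)]
      rw [Finset.prod_congr rfl (g := fun _ => 2 ^ h) (fun k hk => by
        rw [if_neg (Finset.ne_of_mem_erase hk), Finset.card_range])]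
      simp [Finset.card_erase_of_mem]
    rw [h2] at h1
    exact_mod_cast h1
  rw [Finset.card_eq_sum_card_image f G]
  push_cast
  calc _ ≤ ∑ v ∈ G.image f, (2 * η + 1) := by
        apply Finset.sum_le_sum
        intro v _
        have hinj : Set.InjOn (fun u : Fin d → ℕ => (u i : ℤ))
            ((G.filter (fun u => f u = v) : Finset _) : Set (Fin d → ℕ)) := by
          intro u1 h1 u2 h2 h
          simp only [Finset.coe_filter, Set.mem_setOf_eq] at h1 h2
          have h3 := h1.2.trans h2.2.symm
          ext k
          by_cases hk : k = i
          · subst hk; simpa using h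
          · have := congrFun h3 k
            simpa [f, Function.update_of_ne hk] using this
        rw [← Finset.card_image_of_injOn hinj]
        set C : ℝ := ∑ k, (r.1 k : ℝ) * (x k + (v k : ℝ) / 2 ^ L) - r.2 with hC
        apply int_count _ (-C * 2 ^ L / r.1 i) η hη0
        intro n hn
        obtain ⟨u, hu, rfl⟩ := Finset.mem_image.mp hn
        rw [Finset.mem_filter] at hu
        have hhit := (Finset.mem_filter.mp hu.1).2
        have huv := hu.2
        unfold HitP at hhit
        have e1 : ∑ k, (r.1 k : ℝ) * chd x L u k - r.2 = C + r.1 i * (u i) / 2 ^ L := by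
          have : ∀ k, (r.1 k : ℝ) * chd x L u k = (r.1 k : ℝ) * (x k + (v k : ℝ) / 2 ^ L) +
              if k = i then (r.1 i : ℝ) * (u i) / 2 ^ L else 0 := by
            intro k
            rw [← huv]
            by_cases hk : k = i
            · subst hk; simp [f, chd]; ring
            · simp [f, chd, hk]
          simp only [this, Finset.sum_add_distrib, Finset.sum_ite_eq', Finset.mem_univ, if_true, hC]
          ring
        rw [e1] at hhit
        have e2 : -C * 2 ^ L / r.1 i - ((u i : ℤ) : ℝ) =
            -((C + r.1 i * (u i) / 2 ^ L) * 2 ^ L / r.1 i) := by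
          push_cast; field_simp; ring
        rw [e2, abs_neg, abs_div, abs_mul, abs_of_pos (by positivity : (0 : ℝ) < 2 ^ L), hη]
        gcongr
    _ = (G.image f).card * (2 * η + 1) := by rw [Finset.sum_const, nsmul_eq_mul]
    _ ≤ _ := by gcongr

open Classical in
lemma step (d : ℕ) (hd : 1 ≤ d) (x : Fin d → ℝ) (ℓ h p p' : ℕ)
    (A B : Finset ((Fin d → ℤ) × ℤ))
    (hA : ∀ r ∈ A, r.1 ≠ 0 ∧ SS (szv r.1) + p ≤ ℓ + h)
    (hB : ∀ r ∈ B, r.1 ≠ 0 ∧ ℓ + h ≤ SS (szv r.1) + p')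
    (hW : (4 * d + 5) * (2 : ℝ) ^ ℓ * ∑ r ∈ A, 1 / (2 : ℝ) ^ SS (szv r.1) ≤ 2 ^ p / 2) :
    ∃ u : Fin d → ℕ, (∀ i, u i < 2 ^ h) ∧ (∀ r ∈ A, ¬ HitP p (chd x (ℓ + h) u) (ℓ + h) r) ∧
      ∑ r ∈ B.filter (fun r => HitP p' (chd x (ℓ + h) u) (ℓ + h) r), 1 / (2 : ℝ) ^ SS (szv r.1) ≤
        2 * (4 * d + 5) / 2 ^ h * ∑ r ∈ B, 1 / (2 : ℝ) ^ SS (szv r.1) := by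
  set U := Fintype.piFinset (fun _ : Fin d => Finset.range (2 ^ h)) with hU
  set WA := ∑ r ∈ A, 1 / (2 : ℝ) ^ SS (szv r.1) with hWA
  set WB := ∑ r ∈ B, 1 / (2 : ℝ) ^ SS (szv r.1) with hWB
  set H : ℝ := 2 ^ h with hH
  have hHpos : 0 < H := by positivity
  have hUc : (U.card : ℝ) = H ^ d := by rw [hU, Fintype.card_piFinset]; simp [hH]
  have hHd : H ^ d = H ^ (d - 1) * H := by rw [← pow_succ]; congr 1; omega
  have hHd1 : 0 < H ^ (d - 1) := by positivity
  set bad := U.filter (fun u => ∃ r ∈ A, HitP p (chd x (ℓ + h) u) (ℓ + h) r) with hbad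
  have hbadc : (bad.card : ℝ) ≤ H ^ d / 2 := by
    have h1 : bad ⊆ A.biUnion (fun r => U.filter (fun u => HitP p (chd x (ℓ + h) u) (ℓ + h) r)) := by
      intro u hu
      rw [hbad, Finset.mem_filter] at hu
      obtain ⟨hu1, r, hr, hh⟩ := hu
      rw [Finset.mem_biUnion]
      exact ⟨r, hr, Finset.mem_filter.mpr ⟨hu1, hh⟩⟩
    have h2 := (Finset.card_le_card h1).trans Finset.card_biUnion_le
    have h3 : (bad.card : ℝ) ≤ ∑ r ∈ A, ((U.filter (fun u => HitP p (chd x (ℓ + h) u) (ℓ + h) r)).card : ℝ) := by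
      exact_mod_cast h2
    refine h3.trans ?_
    calc _ ≤ ∑ r ∈ A, (H ^ (d - 1) * ((4 * d + 5) * (2 ^ ℓ * H / 2 ^ p))) * (1 / (2 : ℝ) ^ SS (szv r.1)) := by
          apply Finset.sum_le_sum
          intro r hr
          refine (child_count d x (ℓ + h) h p r (hA r hr).1).trans ?_
          rw [mul_assoc]
          apply mul_le_mul_of_nonneg_left _ hHd1.le
          have hge : (1 : ℝ) ≤ 2 ^ (ℓ + h) / 2 ^ (SS (szv r.1) + p) := by
            rw [le_div_iff₀ (by positivity), one_mul]
            exact pow_le_pow_right₀ (by norm_num) (hA r hr).2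
          have e : (4 * (d : ℝ) + 5) * (2 ^ ℓ * H / 2 ^ p) * (1 / 2 ^ SS (szv r.1)) =
              (4 * d + 5) * (2 ^ (ℓ + h) / 2 ^ (SS (szv r.1) + p)) := by
            rw [hH, pow_add, pow_add]; field_simp
          rw [e]
          have hd0 : (0 : ℝ) ≤ d := Nat.cast_nonneg d
          nlinarith
      _ = H ^ (d - 1) * H / 2 ^ p * ((4 * d + 5) * 2 ^ ℓ * WA) := by
          rw [← Finset.mul_sum]; ring
      _ ≤ H ^ (d - 1) * H / 2 ^ p * (2 ^ p / 2) := by gcongr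
      _ = H ^ d / 2 := by rw [hHd]; field_simp
  set good := U \ bad with hgood
  have hgoodc : H ^ d / 2 ≤ (good.card : ℝ) := by
    have h1 : good.card + bad.card = U.card := Finset.card_sdiff_add_card_eq_card (Finset.filter_subset _ _)
    have h2 : (good.card : ℝ) + bad.card = H ^ d := by rw [← hUc]; exact_mod_cast h1
    linarith
  have hgne : good.Nonempty := by
    rw [← Finset.card_pos]
    have : (0 : ℝ) < good.card := lt_of_lt_of_le (by positivity) hgoodc
    exact_mod_cast this
  set f : (Fin d → ℕ) → ℝ := fun u => ∑ r ∈ B.filter (fun r => HitP p' (chd x (ℓ + h) u) (ℓ + h) r),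
    1 / (2 : ℝ) ^ SS (szv r.1) with hf
  have hf0 : ∀ u, 0 ≤ f u := fun u => Finset.sum_nonneg (fun _ _ => by positivity)
  have hsum : ∑ u ∈ U, f u ≤ H ^ (d - 1) * (4 * d + 5) * WB := by
    have e : ∑ u ∈ U, f u = ∑ r ∈ B, ((U.filter (fun u => HitP p' (chd x (ℓ + h) u) (ℓ + h) r)).card : ℝ) *
        (1 / (2 : ℝ) ^ SS (szv r.1)) := by
      simp only [hf, Finset.sum_filter]
      rw [Finset.sum_comm]
      apply Finset.sum_congr rfl
      intro r _
      rw [← Finset.sum_filter, Finset.sum_const, nsmul_eq_mul]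
    rw [e, hWB, Finset.mul_sum]
    apply Finset.sum_le_sum
    intro r hr
    apply mul_le_mul_of_nonneg_right _ (by positivity)
    refine (child_count d x (ℓ + h) h p' r (hB r hr).1).trans ?_
    apply mul_le_mul_of_nonneg_left _ hHd1.le
    have hle : (2 : ℝ) ^ (ℓ + h) / 2 ^ (SS (szv r.1) + p') ≤ 1 := by
      rw [div_le_one (by positivity)]
      exact pow_le_pow_right₀ (by norm_num) (hB r hr).2
    linarith
  have hex : ∃ u ∈ good, f u ≤ 2 * (4 * d + 5) / H * WB := by
    by_contra hcon
    push Not at hcon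
    have h1 : ∑ u ∈ good, 2 * (4 * d + 5) / H * WB < ∑ u ∈ good, f u :=
      Finset.sum_lt_sum_of_nonempty hgne hcon
    rw [Finset.sum_const, nsmul_eq_mul] at h1
    have h2 : ∑ u ∈ good, f u ≤ ∑ u ∈ U, f u :=
      Finset.sum_le_sum_of_subset_of_nonneg Finset.sdiff_subset (fun u _ _ => hf0 u)
    have hWB0 : 0 ≤ WB := Finset.sum_nonneg (fun _ _ => by positivity)
    have h3 : H ^ d / 2 * (2 * (4 * d + 5) / H * WB) ≤ good.card * (2 * (4 * d + 5) / H * WB) := by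
      gcongr
    have h4 : H ^ d / 2 * (2 * (4 * d + 5) / H * WB) = H ^ (d - 1) * (4 * d + 5) * WB := by
      rw [hHd]; field_simp
    linarith
  obtain ⟨u, hu, hfu⟩ := hex
  rw [hgood, Finset.mem_sdiff] at hu
  refine ⟨u, by simpa [hU] using hu.1, ?_, hfu⟩
  intro r hr hh
  exact hu.2 (Finset.mem_filter.mpr ⟨hu.1, r, hr, hh⟩)

lemma SS_bound_i {d : ℕ} (a : Fin d → ℕ) (i : Fin d) : a i ≤ SS a := by
  have := le_XX a i; unfold SS; omega

lemma hit_finite (d : ℕ) (T p : ℕ) (x : Fin d → ℝ) (ℓ : ℕ) :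
    {r : (Fin d → ℤ) × ℤ | SS (szv r.1) < T ∧ HitP p x ℓ r}.Finite := by
  have hm : {m : Fin d → ℤ | SS (szv m) < T}.Finite := by
    apply (Set.Finite.pi (t := fun _ : Fin d => Set.Icc (-(2 ^ T : ℤ)) (2 ^ T))
      (fun _ => Set.finite_Icc _ _)).subset
    intro m hm
    simp only [Set.mem_setOf_eq] at hm
    simp only [Set.mem_pi, Set.mem_univ, forall_true_left, Set.mem_Icc]
    intro i
    rw [← abs_le]
    have h1 := szv_lt m i
    have h2 : (2 : ℝ) ^ szv m i ≤ 2 ^ T :=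
      pow_le_pow_right₀ (by norm_num) ((SS_bound_i _ i).trans hm.le)
    have h3 : |(m i : ℝ)| ≤ 2 ^ T := h1.le.trans h2
    exact_mod_cast h3
  apply (hm.biUnion (t := fun m => {m} ×ˢ {n : ℤ | HitP p x ℓ (m, n)}) (fun m _ => by
    apply (Set.finite_singleton m).prod
    set R : ℝ := 1 / 2 ^ (JJ (szv m) + p) + d * 2 ^ (XX (szv m)) / 2 ^ ℓ with hR
    set y : ℝ := ∑ i, (m i : ℝ) * x i with hy
    apply (Set.finite_Icc ⌊y - R⌋ ⌈y + R⌉).subset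
    intro n hn
    have hn' : |y - n| < R := hn
    rw [abs_lt] at hn'
    constructor
    · have : (⌊y - R⌋ : ℝ) ≤ n := (Int.floor_le _).trans (by linarith)
      exact_mod_cast this
    · have : (n : ℝ) ≤ ⌈y + R⌉ := le_trans (by linarith) (Int.le_ceil _)
      exact_mod_cast this)).subset
  rintro ⟨m, n⟩ hr
  simp only [Set.mem_iUnion]
  exact ⟨m, hr.1, rfl, hr.2⟩

/-- shapes with scale in a block -/
def shp (d T0 T1 : ℕ) : Finset (Fin d → ℕ) :=
  (Fintype.piFinset (fun _ : Fin d => Finset.range T1)).filter (fun a => T0 ≤ SS a ∧ SS a < T1)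

lemma mem_shp {d T0 T1 : ℕ} (a : Fin d → ℕ) : a ∈ shp d T0 T1 ↔ T0 ≤ SS a ∧ SS a < T1 := by
  unfold shp
  rw [Finset.mem_filter]
  constructor
  · exact fun h => h.2
  · intro h
    refine ⟨?_, h⟩
    rw [Fintype.mem_piFinset]
    intro i
    rw [Finset.mem_range]
    exact lt_of_le_of_lt (SS_bound_i a i) h.2

lemma hit_mono {d : ℕ} {p p' : ℕ} (hp : p ≤ p') (x : Fin d → ℝ) (ℓ : ℕ) (r : (Fin d → ℤ) × ℤ)
    (h : HitP p' x ℓ r) : HitP p x ℓ r := by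
  unfold HitP at *
  refine lt_of_lt_of_le h ?_
  gcongr
  norm_num

lemma weight_bound (d : ℕ) (x : Fin d → ℝ) (ℓ p p' T0 T1 : ℕ) (B : Finset ((Fin d → ℤ) × ℤ))
    (hB : ∀ r ∈ B, (T0 ≤ SS (szv r.1) ∧ SS (szv r.1) < T1) ∧ HitP p' x ℓ r)
    (hT : ℓ = 0 ∨ ℓ + d * (p + 2 * d) ≤ T0)
    (hgood : ∀ m : Fin d → ℤ, m ≠ 0 → SS (szv m) + p < ℓ → ∀ n : ℤ,
      1 / (2 : ℝ) ^ (JJ (szv m) + p) ≤ |∑ i, (m i : ℝ) * x i - n|) :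
    ∑ r ∈ B, 1 / (2 : ℝ) ^ SS (szv r.1) ≤ K2c d * (shp d T0 T1).card / 2 ^ ℓ := by
  classical
  have hmaps : ∀ r ∈ B, szv r.1 ∈ shp d T0 T1 := fun r hr => (mem_shp (szv r.1)).mpr (hB r hr).1
  rw [← Finset.sum_fiberwise_of_maps_to hmaps]
  calc _ ≤ ∑ a ∈ shp d T0 T1, K2c d / 2 ^ ℓ := by
        apply Finset.sum_le_sum
        intro a ha
        rw [Finset.sum_congr rfl (g := fun _ => 1 / (2 : ℝ) ^ SS a) (fun r hr => by
          rw [(Finset.mem_filter.mp hr).2])]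
        rw [Finset.sum_const, nsmul_eq_mul]
        have hc := shape_count d x ℓ p a (by
            rcases hT with h | h
            · exact Or.inl h
            · exact Or.inr (h.trans ((mem_shp a).mp ha).1)) hgood (B.filter (fun r => szv r.1 = a)) (by
          intro r hr
          rw [Finset.mem_filter] at hr
          refine ⟨hr.2, ?_⟩
          have := hit_mono (Nat.zero_le p') x ℓ r (hB r hr.1).2
          unfold HitP at this
          rw [hr.2] at this
          simpa using this)
        calc _ ≤ (K2c d * (2 ^ SS a / 2 ^ ℓ)) * (1 / (2 : ℝ) ^ SS a) := by gcongr
          _ = _ := by field_simp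
    _ = _ := by rw [Finset.sum_const, nsmul_eq_mul]; ring

lemma construct (d : ℕ) (hd : 1 ≤ d) (s q : ℕ → ℕ) (hs0 : s 0 = 0) (hq0 : q 0 = 0) (hq : Monotone q)
    (hgap : ∀ k, s k + (d + 1) * q k + 2 * d ^ 2 ≤ s (k + 1))
    (hcount : ∀ k, 4 * (4 * d + 5) ^ 2 * K2c d * (shp d (s k) (s (k + 1))).card ≤ 2 ^ q (k + 1)) :
    ∃ α : Fin d → ℝ, ∀ k, ∀ m : Fin d → ℤ, m ≠ 0 → SS (szv m) < s k → ∀ n : ℤ,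
      1 / (2 : ℝ) ^ (JJ (szv m) + q k) ≤ |∑ i, (m i : ℝ) * α i - n| := by
  classical
  have hK2 : 0 < K2c d := by unfold K2c; positivity
  set ℓ : ℕ → ℕ := fun k => s k + q k with hℓ
  let P : ℕ → (Fin d → ℝ) → Prop := fun k x =>
    (∀ m : Fin d → ℤ, m ≠ 0 → SS (szv m) < s k → ∀ n : ℤ, ¬ HitP (q k) x (ℓ k) (m, n)) ∧
    (∀ A : Finset ((Fin d → ℤ) × ℤ), (∀ r ∈ A, r.1 ≠ 0 ∧ (s k ≤ SS (szv r.1) ∧ SS (szv r.1) < s (k + 1)) ∧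
      HitP (q (k + 1)) x (ℓ k) r) →
      (4 * d + 5) * (2 : ℝ) ^ ℓ k * ∑ r ∈ A, 1 / (2 : ℝ) ^ SS (szv r.1) ≤ 2 ^ q (k + 1) / 2)
  let R : ℕ → (Fin d → ℝ) → (Fin d → ℝ) → Prop := fun k x x' =>
    ∀ i, 0 ≤ x' i - x i ∧ x' i - x i ≤ 1 / 2 ^ ℓ k - 1 / 2 ^ ℓ (k + 1)
  have hℓmono : ∀ k, ℓ k ≤ ℓ (k + 1) := by
    intro k
    have h1 := hgap k
    have h2 := hq (Nat.le_succ k)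
    simp only [hℓ]
    have : 0 ≤ (d + 1) * q k := Nat.zero_le _
    simp only [Nat.succ_eq_add_one] at h2
    omega
  have hbase : P 0 0 := by
    refine ⟨?_, ?_⟩
    · intro m _ h; rw [hs0] at h; omega
    · intro A hA
      have h0 : ℓ 0 = 0 := by simp [hℓ, hs0, hq0]
      have hw := weight_bound d (0 : Fin d → ℝ) (ℓ 0) 0 (q 1) (s 0) (s 1) A
        (fun r hr => (hA r hr).2) (Or.inl h0) (by intro m _ h; rw [h0] at h; omega)
      rw [h0] at hw ⊢
      have hc := hcount 0
      simp only [zero_add, pow_zero, mul_one, div_one] at *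
      set c : ℝ := ((shp d (s 0) (s 1)).card : ℝ)
      have hc0 : 0 ≤ c := Nat.cast_nonneg _
      have hd0 : (0 : ℝ) ≤ d := Nat.cast_nonneg d
      have h1 : (4 * (d : ℝ) + 5) * ∑ r ∈ A, 1 / (2 : ℝ) ^ SS (szv r.1) ≤ (4 * d + 5) * (K2c d * c) := by
        gcongr
      have h2 : 0 ≤ K2c d * c := by positivity
      nlinarith [mul_nonneg hd0 h2, mul_nonneg (mul_nonneg hd0 hd0) h2]
  have hstep : ∀ k x, P k x → ∃ x', P (k + 1) x' ∧ R k x x' := by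
    intro k x hP
    obtain ⟨I1, I2⟩ := hP
    obtain ⟨h, hh⟩ := Nat.exists_eq_add_of_le (hℓmono k)
    have hfinA := (hit_finite d (s (k + 1)) (q (k + 1)) x (ℓ k)).subset
      (t := {r : (Fin d → ℤ) × ℤ | r.1 ≠ 0 ∧ (s k ≤ SS (szv r.1) ∧ SS (szv r.1) < s (k + 1)) ∧ HitP (q (k + 1)) x (ℓ k) r})
      (fun r hr => ⟨hr.2.1.2, hr.2.2⟩)
    have hfinB := (hit_finite d (s (k + 2)) (q (k + 2)) x (ℓ k)).subset
      (t := {r : (Fin d → ℤ) × ℤ | r.1 ≠ 0 ∧ (s (k + 1) ≤ SS (szv r.1) ∧ SS (szv r.1) < s (k + 2)) ∧ HitP (q (k + 2)) x (ℓ k) r})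
      (fun r hr => ⟨hr.2.1.2, hr.2.2⟩)
    set A := hfinA.toFinset with hAdef
    set B := hfinB.toFinset with hBdef
    have hA : ∀ r, r ∈ A ↔ r.1 ≠ 0 ∧ (s k ≤ SS (szv r.1) ∧ SS (szv r.1) < s (k + 1)) ∧
        HitP (q (k + 1)) x (ℓ k) r := by intro r; simp [hAdef]
    have hB : ∀ r, r ∈ B ↔ r.1 ≠ 0 ∧ (s (k + 1) ≤ SS (szv r.1) ∧ SS (szv r.1) < s (k + 2)) ∧
        HitP (q (k + 2)) x (ℓ k) r := by intro r; simp [hBdef]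
    have hq12 : q (k + 1) ≤ q (k + 2) := hq (by omega)
    have hℓ1 : ℓ (k + 1) = s (k + 1) + q (k + 1) := rfl
    obtain ⟨u, hu, hu1, hu2⟩ := step d hd x (ℓ k) h (q (k + 1)) (q (k + 2)) A B
      (fun r hr => ⟨((hA r).mp hr).1, by have := ((hA r).mp hr).2.1.2; rw [← hh, hℓ1]; omega⟩)
      (fun r hr => ⟨((hB r).mp hr).1, by have := ((hB r).mp hr).2.1.1; rw [← hh, hℓ1]; omega⟩)
      (I2 A (fun r hr => (hA r).mp hr))
    refine ⟨chd x (ℓ k + h) u, ⟨?_, ?_⟩, ?_⟩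
    · intro m hm hS n hhit
      rw [hh] at hhit
      have hpar := hit_parent _ x (ℓ k) h u hu _ hhit
      rcases lt_or_ge (SS (szv m)) (s k) with hlt | hge
      · exact I1 m hm hlt n (hit_mono (hq (Nat.le_succ k)) x _ _ hpar)
      · exact hu1 (m, n) ((hA _).mpr ⟨hm, ⟨hge, hS⟩, hpar⟩) hhit
    · intro A' hA'
      have hsub : A' ⊆ B.filter (fun r => HitP (q (k + 2)) (chd x (ℓ k + h) u) (ℓ k + h) r) := by
        intro r hr
        obtain ⟨h1, h2, h3⟩ := hA' r hr
        rw [hh] at h3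
        rw [Finset.mem_filter]
        exact ⟨(hB r).mpr ⟨h1, h2, hit_parent _ x (ℓ k) h u hu _ h3⟩, h3⟩
      have hw1 : ∑ r ∈ A', 1 / (2 : ℝ) ^ SS (szv r.1) ≤ _ :=
        (Finset.sum_le_sum_of_subset_of_nonneg hsub (fun _ _ _ => by positivity)).trans hu2
      have hw2 := weight_bound d x (ℓ k) (q k) (q (k + 2)) (s (k + 1)) (s (k + 2)) B
        (fun r hr => ((hB r).mp hr).2) (Or.inr (by
          have := hgap k
          simp only [hℓ]
          nlinarith)) (by
          intro m hm hS n
          have := I1 m hm (by simp only [hℓ] at hS; omega) n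
          unfold HitP at this
          push Not at this
          refine le_trans ?_ this
          have : (0 : ℝ) ≤ d * 2 ^ XX (szv m) / 2 ^ ℓ k := by positivity
          simp only
          linarith)
      have hc := hcount (k + 1)
      have hd0 : (0 : ℝ) ≤ d := Nat.cast_nonneg d
      calc (4 * d + 5) * (2 : ℝ) ^ ℓ (k + 1) * ∑ r ∈ A', 1 / (2 : ℝ) ^ SS (szv r.1)
          ≤ (4 * d + 5) * (2 : ℝ) ^ ℓ (k + 1) * (2 * (4 * d + 5) / 2 ^ h *
            (K2c d * (shp d (s (k + 1)) (s (k + 2))).card / 2 ^ ℓ k)) := by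
            gcongr
            refine hw1.trans ?_
            gcongr
        _ = (4 * (4 * d + 5) ^ 2 * K2c d * (shp d (s (k + 1)) (s (k + 2))).card) / 2 := by
            rw [hh, pow_add]; field_simp; ring
        _ ≤ _ := by gcongr
    · intro i
      have := chd_diff x (ℓ k) h u hu i
      rw [hh]
      exact this
  choose! nx hnx1 hnx2 using hstep
  let X : ℕ → (Fin d → ℝ) := fun k => Nat.rec 0 (fun k x => nx k x) k
  have hXs : ∀ k, X (k + 1) = nx k (X k) := fun k => rfl
  have hXP : ∀ k, P k (X k) := by
    intro k
    induction k with
    | zero => exact hbase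
    | succ k ih => rw [hXs]; exact hnx1 k _ ih
  have hXR : ∀ k, R k (X k) (X (k + 1)) := fun k => by rw [hXs]; exact hnx2 k _ (hXP k)
  have hmono : ∀ i, Monotone (fun k => X k i) := fun i =>
    monotone_nat_of_le_succ (fun k => by have := (hXR k i).1; linarith)
  have hanti : ∀ i, Antitone (fun k => X k i + 1 / 2 ^ ℓ k) := fun i =>
    antitone_nat_of_succ_le (fun k => by have := (hXR k i).2; linarith)
  have hbd : ∀ i k j, X j i ≤ X k i + 1 / 2 ^ ℓ k := by
    intro i k j
    have hp : ∀ j, (0 : ℝ) ≤ 1 / 2 ^ ℓ j := fun j => by positivity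
    rcases le_total j k with hjk | hjk
    · have := hmono i hjk
      simp only at this
      linarith [hp k]
    · have := hanti i hjk
      simp only at this
      linarith [hp j]
  refine ⟨fun i => ⨆ k, X k i, ?_⟩
  intro k m hm hS n
  have hα : ∀ i, |X k i - (⨆ k, X k i)| ≤ 1 / 2 ^ ℓ k := by
    intro i
    have h1 : X k i ≤ ⨆ k, X k i := le_ciSup (f := fun k => X k i)
      ⟨X k i + 1 / 2 ^ ℓ k, by rintro _ ⟨j, rfl⟩; exact hbd i k j⟩ k
    have h2 : (⨆ k, X k i) ≤ X k i + 1 / 2 ^ ℓ k := ciSup_le (hbd i k)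
    rw [abs_le]; constructor <;> linarith
  have h1 := (hXP k).1 m hm hS n
  unfold HitP at h1
  push Not at h1
  simp only at h1
  have h2 := lin_diff m (X k) (fun i => ⨆ k, X k i) (1 / 2 ^ ℓ k) hα n
  rw [mul_one_div] at h2
  linarith


lemma shp_card (d : ℕ) (hd : 1 ≤ d) (T0 T1 : ℕ) :
    (shp d T0 T1).card ≤ d * ((T1 - T0) * T1 ^ (d - 1)) := by
  classical
  have hsub : shp d T0 T1 ⊆ (Finset.univ : Finset (Fin d)).biUnion
      (fun i => (shp d T0 T1).filter (fun a => a i = XX a)) := by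
    intro a ha
    rw [Finset.mem_biUnion]
    obtain ⟨i, _, hi⟩ := Finset.exists_mem_eq_sup (Finset.univ : Finset (Fin d))
      ⟨⟨0, hd⟩, Finset.mem_univ _⟩ a
    exact ⟨i, Finset.mem_univ _, Finset.mem_filter.mpr ⟨ha, hi.symm⟩⟩
  refine (Finset.card_le_card hsub).trans (Finset.card_biUnion_le.trans ?_)
  calc _ ≤ ∑ i : Fin d, (T1 - T0) * T1 ^ (d - 1) := by
        apply Finset.sum_le_sum
        intro i _
        have hc : (Finset.Ico T0 T1 ×ˢ Fintype.piFinset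
            (fun k : Fin d => if k = i then {0} else Finset.range T1)).card =
            (T1 - T0) * T1 ^ (d - 1) := by
          rw [Finset.card_product, Nat.card_Ico, Fintype.card_piFinset,
            ← Finset.mul_prod_erase _ _ (Finset.mem_univ i)]
          rw [Finset.prod_congr rfl (g := fun _ => T1) (fun k hk => by
            rw [if_neg (Finset.ne_of_mem_erase hk), Finset.card_range])]
          simp [Finset.card_erase_of_mem]
        rw [← hc]
        apply Finset.card_le_card_of_injOn (fun a => (SS a, Function.update a i 0))
        · intro a ha
          have ha1 := (mem_shp a).mp (Finset.mem_filter.mp ha).1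
          simp only [Finset.coe_product, Set.mem_prod, Finset.mem_coe, Finset.mem_Ico,
            Fintype.mem_piFinset]
          refine ⟨ha1, ?_⟩
          intro k
          by_cases hk : k = i
          · subst hk; simp
          · simp only [Function.update_of_ne hk, if_neg hk, Finset.mem_range]
            exact lt_of_le_of_lt (SS_bound_i a k) ha1.2
        · intro a ha b hb hab
          have ha2 : a i = XX a := (Finset.mem_filter.mp ha).2
          have hb2 : b i = XX b := (Finset.mem_filter.mp hb).2
          simp only [Prod.mk.injEq] at hab
          obtain ⟨h1, h2⟩ := hab
          have hk : ∀ k, k ≠ i → a k = b k := by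
            intro k hk
            have := congrFun h2 k
            simpa [Function.update_of_ne hk] using this
          have hi : a i = b i := by
            have hsum : ∑ k ∈ Finset.univ.erase i, a k = ∑ k ∈ Finset.univ.erase i, b k :=
              Finset.sum_congr rfl (fun k hk2 => hk k (Finset.ne_of_mem_erase hk2))
            have ea := Finset.add_sum_erase Finset.univ a (Finset.mem_univ i)
            have eb := Finset.add_sum_erase Finset.univ b (Finset.mem_univ i)
            unfold SS JJ at h1
            omega
          ext k
          by_cases h : k = i
          · rw [h, hi]
          · exact hk k h
    _ = _ := by simp

/-- the pair (scale, bits) of the block construction -/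
def stq (d A : ℕ) : ℕ → ℕ × ℕ
  | 0 => (0, 0)
  | k + 1 =>
    ((stq d A k).1 + (d + 1) * (stq d A k).2 + 2 * d ^ 2,
      max (stq d A k).2 (Nat.clog 2 (A * (d * (((d + 1) * (stq d A k).2 + 2 * d ^ 2) *
        ((stq d A k).1 + (d + 1) * (stq d A k).2 + 2 * d ^ 2) ^ (d - 1))))))

lemma two_pow_clog_le (n : ℕ) (hn : 1 ≤ n) : 2 ^ Nat.clog 2 n ≤ 2 * n := by
  rcases Nat.lt_or_ge 1 n with h | h
  · have h1 := Nat.pow_pred_clog_lt_self (b := 2) (by norm_num) h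
    have h2 : 0 < Nat.clog 2 n := Nat.clog_pos (by norm_num) h
    rw [Nat.pred_eq_sub_one] at h1
    calc 2 ^ Nat.clog 2 n = 2 * 2 ^ (Nat.clog 2 n - 1) := by rw [← pow_succ']; congr 1; omega
      _ ≤ 2 * n := by omega
  · have : n = 1 := by omega
    subst this; simp

lemma lam_pos (s : ℕ) : 1 ≤ Nat.log 2 (s + 2) := Nat.log_pos (by norm_num) (by omega)

lemma lam_le (s : ℕ) : Nat.log 2 (s + 2) ≤ s + 1 := by
  have : Nat.log 2 (s + 2) < s + 2 := Nat.log_lt_self 2 (by omega)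
  omega

lemma stq_growth (d A c : ℕ) (hd : 1 ≤ d) (hA : 1 ≤ A)
    (hc : 2 * A * d * ((d + 1) * (c + 2 * d) + 2 * d ^ 2) ≤ 2 ^ c) (k : ℕ) :
    2 ^ (stq d A k).2 ≤ 2 ^ c * (((stq d A k).1 + 1) ^ (d - 1) * Nat.log 2 ((stq d A k).1 + 2)) ∧
    (d + 1) * (stq d A k).2 + 2 * d ^ 2 ≤
      ((d + 1) * (c + 2 * d) + 2 * d ^ 2) * Nat.log 2 ((stq d A k).1 + 2) := by
  have key : ∀ s q, 2 ^ q ≤ 2 ^ c * ((s + 1) ^ (d - 1) * Nat.log 2 (s + 2)) →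
      (d + 1) * q + 2 * d ^ 2 ≤ ((d + 1) * (c + 2 * d) + 2 * d ^ 2) * Nat.log 2 (s + 2) := by
    intro s q h
    have hl := lam_pos s
    set l := Nat.log 2 (s + 2) with hldef
    have h1 : s + 2 < 2 ^ (l + 1) := Nat.lt_pow_succ_log_self (by norm_num) _
    have h2 : 2 ^ q ≤ 2 ^ (c + (l + 1) * d) := by
      calc 2 ^ q ≤ 2 ^ c * ((s + 1) ^ (d - 1) * l) := h
        _ ≤ 2 ^ c * ((2 ^ (l + 1)) ^ (d - 1) * 2 ^ (l + 1)) := by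
            have := lam_le s
            gcongr
            · omega
            · omega
        _ = 2 ^ (c + (l + 1) * d) := by
            rw [← pow_succ, ← pow_mul, ← pow_add]
            congr 3
            omega
    have h3 : q ≤ c + (l + 1) * d := (Nat.pow_le_pow_iff_right (by norm_num)).mp h2
    have h4 : q ≤ (c + 2 * d) * l := by nlinarith
    calc (d + 1) * q + 2 * d ^ 2 ≤ (d + 1) * ((c + 2 * d) * l) + 2 * d ^ 2 * l := by
          have : 2 * d ^ 2 ≤ 2 * d ^ 2 * l := Nat.le_mul_of_pos_right _ hl
          have := Nat.mul_le_mul_left (d + 1) h4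
          omega
      _ = _ := by ring
  have main : 2 ^ (stq d A k).2 ≤ 2 ^ c * (((stq d A k).1 + 1) ^ (d - 1) * Nat.log 2 ((stq d A k).1 + 2)) := by
    induction k with
    | zero =>
      simp only [stq]
      have h0 := lam_pos 0
      have : 0 < 2 ^ c * ((0 + 1) ^ (d - 1) * Nat.log 2 (0 + 2)) := by positivity
      rw [pow_zero]
      exact this
    | succ k ih =>
      have hk := key _ _ ih
      simp only [stq]
      set s := (stq d A k).1
      set q := (stq d A k).2
      set Δ := (d + 1) * q + 2 * d ^ 2 with hΔ
      have hs' : s + (d + 1) * q + 2 * d ^ 2 = s + Δ := by rw [hΔ]; ring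
      rw [hs']
      have hlog : Nat.log 2 (s + 2) ≤ Nat.log 2 (s + Δ + 2) := Nat.log_mono_right (by omega)
      have hΔ1 : 1 ≤ Δ := by
        have : 1 ≤ d ^ 2 := Nat.one_le_pow _ _ hd
        omega
      rcases max_choice q (Nat.clog 2 (A * (d * (Δ * (s + Δ) ^ (d - 1))))) with h | h
      · rw [h]
        refine ih.trans ?_
        gcongr
        omega
      · rw [h]
        have hn1 : 1 ≤ A * (d * (Δ * (s + Δ) ^ (d - 1))) := by
          have : 0 < (s + Δ) ^ (d - 1) := Nat.pow_pos (by omega)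
          have : 0 < A * (d * (Δ * (s + Δ) ^ (d - 1))) := by positivity
          omega
        refine (two_pow_clog_le _ hn1).trans ?_
        calc 2 * (A * (d * (Δ * (s + Δ) ^ (d - 1))))
            ≤ 2 * (A * (d * ((((d + 1) * (c + 2 * d) + 2 * d ^ 2) * Nat.log 2 (s + 2)) *
              (s + Δ + 1) ^ (d - 1)))) := by
              exact Nat.mul_le_mul_left _ (Nat.mul_le_mul_left _ (Nat.mul_le_mul_left _
                (Nat.mul_le_mul hk (Nat.pow_le_pow_left (by omega) _))))
          _ = (2 * A * d * ((d + 1) * (c + 2 * d) + 2 * d ^ 2)) *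
              ((s + Δ + 1) ^ (d - 1) * Nat.log 2 (s + 2)) := by ring
          _ ≤ 2 ^ c * ((s + Δ + 1) ^ (d - 1) * Nat.log 2 (s + Δ + 2)) := by gcongr
  exact ⟨main, key _ _ main⟩

lemma exists_c (Y E F : ℕ) : ∃ c : ℕ, Y * (E + F * c) ≤ 2 ^ c := by
  set n := Y * (E + 2 * F) + 1 with hn
  refine ⟨2 * n, ?_⟩
  have h1 : n ≤ 2 ^ n := Nat.lt_two_pow_self.le
  calc Y * (E + F * (2 * n)) ≤ Y * (E * n + F * (2 * n)) := by
        gcongr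
        exact Nat.le_mul_of_pos_right _ (by omega)
    _ = (Y * (E + 2 * F)) * n := by ring
    _ ≤ n * n := by gcongr; omega
    _ ≤ 2 ^ n * 2 ^ n := by gcongr
    _ = 2 ^ (2 * n) := by rw [← pow_add]; congr 1; ring

lemma nat_log_mul_two_pow (n : ℕ) (hn : n ≠ 0) (e : ℕ) :
    Nat.log 2 (n * 2 ^ e) = Nat.log 2 n + e := by
  induction e with
  | zero => simp
  | succ e ih =>
    rw [pow_succ, ← mul_assoc, Nat.log_mul_base (by norm_num) (by positivity), ih]
    ring

lemma bad_exists0 (d : ℕ) (hd : 1 ≤ d) : ∃ α : Fin d → ℝ, ∃ C : ℕ, 1 ≤ C ∧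
    ∀ m : Fin d → ℤ, m ≠ 0 → ∀ n : ℤ,
      1 / ((2 : ℝ) ^ JJ (szv m) * (C * ((SS (szv m) + 1 : ℕ) ^ (d - 1) * (Nat.log 2 (SS (szv m) + 2) : ℕ)))) ≤
        |∑ i, (m i : ℝ) * α i - n| := by
  obtain ⟨A, hA⟩ := exists_nat_ge (4 * (4 * d + 5) ^ 2 * K2c d)
  have hA1 : 1 ≤ A := by
    have hK2 : 0 < K2c d := by unfold K2c; positivity
    have : (0 : ℝ) < A := lt_of_lt_of_le (by positivity) hA
    exact_mod_cast this
  obtain ⟨c, hc⟩ := exists_c (2 * A * d) ((d + 1) * (2 * d) + 2 * d ^ 2) (d + 1)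
  have hc' : 2 * A * d * ((d + 1) * (c + 2 * d) + 2 * d ^ 2) ≤ 2 ^ c := by
    refine le_trans (le_of_eq ?_) hc
    ring
  have hgr := stq_growth d A c hd hA1 hc'
  set s : ℕ → ℕ := fun k => (stq d A k).1 with hs
  set q : ℕ → ℕ := fun k => (stq d A k).2 with hq
  have hss : ∀ k, s (k + 1) = s k + (d + 1) * q k + 2 * d ^ 2 := fun k => rfl
  have hqm : Monotone q := monotone_nat_of_le_succ (fun k => by
    simp only [hq]; conv_rhs => rw [stq]
    exact le_max_left _ _)
  obtain ⟨α, hα⟩ := construct d hd s q rfl rfl hqm (fun k => (hss k).ge) (by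
    intro k
    have h1 := shp_card d hd (s k) (s (k + 1))
    have h2 : A * (d * ((s (k + 1) - s k) * s (k + 1) ^ (d - 1))) ≤ 2 ^ q (k + 1) := by
      have e : s (k + 1) - s k = (d + 1) * q k + 2 * d ^ 2 := by rw [hss]; omega
      rw [e]
      refine (Nat.le_pow_clog (b := 2) (by norm_num) _).trans ?_
      apply Nat.pow_le_pow_right (by norm_num)
      simp only [hq]; conv_rhs => rw [stq]
      exact le_max_right _ _
    calc 4 * (4 * (d : ℝ) + 5) ^ 2 * K2c d * (shp d (s k) (s (k + 1))).card
        ≤ A * (d * ((s (k + 1) - s k) * s (k + 1) ^ (d - 1)) : ℕ) := by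
          gcongr
      _ ≤ 2 ^ q (k + 1) := by exact_mod_cast h2)
  set Dc := (d + 1) * (c + 2 * d) + 2 * d ^ 2 with hDc
  refine ⟨α, 2 ^ c * ((Dc + 1) ^ (d - 1) * (Dc + 1)), ?_, ?_⟩
  · have : 0 < 2 ^ c * ((Dc + 1) ^ (d - 1) * (Dc + 1)) := by positivity
    exact this
  intro m hm n
  set S := SS (szv m) with hS
  have hsge : ∀ k, k ≤ s k := by
    intro k
    induction k with
    | zero => exact Nat.zero_le _
    | succ k ih =>
      rw [hss]
      have : 1 ≤ d ^ 2 := Nat.one_le_pow _ _ hd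
      have : 0 ≤ (d + 1) * q k := Nat.zero_le _
      omega
  have hex : ∃ k, S < s k := ⟨S + 1, hsge (S + 1)⟩
  obtain ⟨k, hk1, hk2⟩ : ∃ k, s k ≤ S ∧ S < s (k + 1) := by
    classical
    have hf := Nat.find_spec hex
    have hpos : Nat.find hex ≠ 0 := by
      intro h
      rw [h] at hf
      simp [hs, stq] at hf
    obtain ⟨k, hk⟩ := Nat.exists_eq_succ_of_ne_zero hpos
    refine ⟨k, ?_, ?_⟩
    · exact not_lt.mp (Nat.find_min hex (by omega))
    · rw [hk] at hf; exact hf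
  refine le_trans ?_ (hα (k + 1) m hm hk2 n)
  have hlS := lam_pos S
  have hlS2 := lam_le S
  have hs1 : s (k + 1) ≤ S + Dc * Nat.log 2 (S + 2) := by
    have h1 := (hgr k).2
    have h2 : Nat.log 2 (s k + 2) ≤ Nat.log 2 (S + 2) := Nat.log_mono_right (by omega)
    have h3 : Dc * Nat.log 2 (s k + 2) ≤ Dc * Nat.log 2 (S + 2) := Nat.mul_le_mul_left _ h2
    have h4 := hss k
    simp only [hs, hq] at *
    omega
  have hs2 : s (k + 1) + 1 ≤ (Dc + 1) * (S + 1) := by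
    have : Dc * Nat.log 2 (S + 2) ≤ Dc * (S + 1) := Nat.mul_le_mul_left _ hlS2
    calc s (k + 1) + 1 ≤ S + Dc * (S + 1) + 1 := by omega
      _ = _ := by ring
  have hs3 : Nat.log 2 (s (k + 1) + 2) ≤ (Dc + 1) * Nat.log 2 (S + 2) := by
    have h1 : s (k + 1) + 2 ≤ (S + 2) * 2 ^ Dc := by
      have h2 : Dc + 1 ≤ 2 ^ Dc := Nat.lt_two_pow_self
      calc s (k + 1) + 2 ≤ (S + 2) * (Dc + 1) := by nlinarith
        _ ≤ _ := by gcongr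
    calc Nat.log 2 (s (k + 1) + 2) ≤ Nat.log 2 ((S + 2) * 2 ^ Dc) := Nat.log_mono_right h1
      _ = Nat.log 2 (S + 2) + Dc := by
          exact nat_log_mul_two_pow (S + 2) (by omega) Dc
      _ ≤ _ := by nlinarith
  have hfin : 2 ^ q (k + 1) ≤ 2 ^ c * ((Dc + 1) ^ (d - 1) * (Dc + 1)) *
      ((S + 1) ^ (d - 1) * Nat.log 2 (S + 2)) := by
    calc 2 ^ q (k + 1) ≤ 2 ^ c * ((s (k + 1) + 1) ^ (d - 1) * Nat.log 2 (s (k + 1) + 2)) := (hgr (k + 1)).1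
      _ ≤ 2 ^ c * (((Dc + 1) * (S + 1)) ^ (d - 1) * ((Dc + 1) * Nat.log 2 (S + 2))) := by gcongr
      _ = _ := by rw [mul_pow]; ring
  have hfin' : (2 : ℝ) ^ q (k + 1) ≤ ((2 ^ c * ((Dc + 1) ^ (d - 1) * (Dc + 1)) : ℕ) : ℝ) *
      ((S + 1 : ℕ) ^ (d - 1) * (Nat.log 2 (S + 2) : ℕ)) := by exact_mod_cast hfin
  apply one_div_le_one_div_of_le (by positivity)
  rw [pow_add]
  gcongr

lemma bad_exists (d : ℕ) (hd : 1 ≤ d) : ∃ α : Fin d → ℝ, ∃ c : ℝ, 0 < c ∧ c ≤ 1 ∧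
    ∀ N : ℕ, 1 ≤ N → ∀ m : Fin d → ℤ, m ≠ 0 → ∏ i, max 1 |(m i : ℝ)| ≤ (N : ℝ) → ∀ n : ℤ,
      c / (((max 1 (Real.log N)) ^ (d - 1) * max 1 (Real.log (max 1 (Real.log N)))) *
        ∏ i, max 1 |(m i : ℝ)|) ≤ |(n : ℝ) - ∑ i, (m i : ℝ) * α i| := by
  obtain ⟨α, C, hC, hα⟩ := bad_exists0 d hd
  set U : ℝ := 2 * (Real.log (2 * d + 6) + 1) with hU
  have hlog6 : 0 ≤ Real.log (2 * d + 6) := Real.log_nonneg (by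
    have : (0 : ℝ) ≤ d := Nat.cast_nonneg d
    linarith)
  have hU1 : 1 ≤ U := by rw [hU]; linarith
  have hd0 : (0 : ℝ) ≤ d := Nat.cast_nonneg d
  have hC1 : (1 : ℝ) ≤ C := by exact_mod_cast hC
  set W : ℝ := 2 ^ d * (C * ((2 * d + 5) ^ (d - 1) * U)) with hW
  have hW1 : 1 ≤ W := by
    have h1 : (1 : ℝ) ≤ 2 ^ d := one_le_pow₀ (by norm_num)
    have h2 : (1 : ℝ) ≤ (2 * d + 5) ^ (d - 1) := one_le_pow₀ (by linarith)
    exact one_le_mul_of_one_le_of_one_le h1 (one_le_mul_of_one_le_of_one_le hC1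
      (one_le_mul_of_one_le_of_one_le h2 hU1))
  refine ⟨α, 1 / W, by positivity, by rw [div_le_one (by positivity)]; exact hW1, ?_⟩
  intro N hN m hm hmN n
  have h := hα m hm n
  rw [abs_sub_comm] at h
  refine le_trans ?_ h
  set Lg : ℝ := max 1 (Real.log N) with hLg
  set LL : ℝ := max 1 (Real.log Lg) with hLL
  set P : ℝ := ∏ i, max 1 |(m i : ℝ)| with hP
  have hLg1 : 1 ≤ Lg := le_max_left _ _
  have hLL1 : 1 ≤ LL := le_max_left _ _
  have hP1 : 0 < P := Finset.prod_pos (fun i _ => lt_of_lt_of_le one_pos (le_max_left _ _))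
  have hN0 : (0 : ℝ) < N := by exact_mod_cast hN
  have hJ : (2 : ℝ) ^ JJ (szv m) ≤ 2 ^ d * P := by
    unfold JJ
    rw [← Finset.prod_pow_eq_pow_sum]
    calc ∏ i, (2 : ℝ) ^ szv m i ≤ ∏ i : Fin d, 2 * max 1 |(m i : ℝ)| := by
          apply Finset.prod_le_prod
          · intro i _; positivity
          · intro i _
            by_cases h0 : szv m i = 0
            · rw [h0, pow_zero]
              have := le_max_left 1 |(m i : ℝ)|
              linarith
            · have h1 : 2 ^ (szv m i - 1) ≤ (m i).natAbs :=
                Nat.lt_size.mp (by unfold szv at *; omega)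
              have h2 : |(m i : ℝ)| = ((m i).natAbs : ℝ) := by rw [Nat.cast_natAbs]; simp
              have h3 : (2 : ℝ) ^ (szv m i - 1) ≤ |(m i : ℝ)| := by
                rw [h2]; exact_mod_cast h1
              have h4 : (2 : ℝ) ^ szv m i = 2 * 2 ^ (szv m i - 1) := by
                rw [← pow_succ']; congr 1; omega
              rw [h4]
              have := le_max_right 1 |(m i : ℝ)|
              linarith
      _ = 2 ^ d * P := by rw [Finset.prod_mul_distrib]; simp [hP]
  have hl2 : (1 / 2 : ℝ) < Real.log 2 := by linarith [Real.log_two_gt_d9]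
  have hJ2 : (JJ (szv m) : ℝ) ≤ (d + 2) * Lg := by
    have h1 : Real.log ((2 : ℝ) ^ JJ (szv m)) ≤ Real.log (2 ^ d * N) :=
      Real.log_le_log (by positivity) (hJ.trans (by gcongr))
    rw [Real.log_pow, Real.log_mul (by positivity) (by positivity), Real.log_pow] at h1
    have h2 : Real.log N ≤ Lg := le_max_right _ _
    have h3 : ((JJ (szv m) : ℝ) - d) * Real.log 2 ≤ Lg := by linarith
    have h4 : (JJ (szv m) : ℝ) - d ≤ 2 * Lg := by
      by_contra hcon
      push Not at hcon
      nlinarith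
    nlinarith
  have hX : XX (szv m) ≤ JJ (szv m) :=
    Finset.sup_le (fun i _ => Finset.single_le_sum (f := szv m) (fun _ _ => Nat.zero_le _) (Finset.mem_univ i))
  have hS : (SS (szv m) : ℝ) ≤ 2 * ((d + 2) * Lg) := by
    have : (XX (szv m) : ℝ) ≤ JJ (szv m) := by exact_mod_cast hX
    unfold SS
    push_cast
    linarith
  have hS1 : ((SS (szv m) + 1 : ℕ) : ℝ) ≤ (2 * d + 5) * Lg := by push_cast; nlinarith
  have hS2 : ((SS (szv m) + 2 : ℕ) : ℝ) ≤ (2 * d + 6) * Lg := by push_cast; nlinarith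
  have hl : ((Nat.log 2 (SS (szv m) + 2) : ℕ) : ℝ) ≤ U * LL := by
    have h1 : ((2 ^ Nat.log 2 (SS (szv m) + 2) : ℕ) : ℝ) ≤ (2 * d + 6) * Lg :=
      le_trans (by exact_mod_cast Nat.pow_log_le_self 2 (by omega)) hS2
    push_cast at h1
    have h2 := Real.log_le_log (by positivity) h1
    rw [Real.log_pow, Real.log_mul (by positivity) (by positivity)] at h2
    have h3 : Real.log Lg ≤ LL := le_max_right _ _
    have h5 : (0 : ℝ) ≤ ((Nat.log 2 (SS (szv m) + 2) : ℕ) : ℝ) := Nat.cast_nonneg _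
    rw [hU]
    nlinarith
  rw [div_div]
  have hlp : (0 : ℝ) < ((Nat.log 2 (SS (szv m) + 2) : ℕ) : ℝ) := by
    exact_mod_cast lam_pos (SS (szv m))
  apply one_div_le_one_div_of_le
  · positivity
  calc (2 : ℝ) ^ JJ (szv m) * (C * ((SS (szv m) + 1 : ℕ) ^ (d - 1) * (Nat.log 2 (SS (szv m) + 2) : ℕ)))
      ≤ (2 ^ d * P) * (C * (((2 * d + 5) * Lg) ^ (d - 1) * (U * LL))) := by gcongr
    _ = W * (Lg ^ (d - 1) * LL * P) := by rw [hW, mul_pow]; ring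

/-- (Corollary of Theorem 5 and the Fregoli–Kleinbock result: for d ≥ 2,
there is an α ∈ ℝ^d whose Kronecker sequence has C³-smooth discrepancy
≪ (log N)^{d−1}·log log N, with the convention log x = max{1, log x}). -/
theorem exists_kronecker_small_smooth_discrepancy
    (d : ℕ) (hd : 2 ≤ d) (w : Fin (d+1) → ℝ → ℝ) (hw : GoodWeights (d+1) 3 w) :
    ∃ α : Fin d → ℝ, ∃ C : ℝ, 0 < C ∧
      ∀ N : ℕ, 1 ≤ N → ∀ γ ρ : Fin d → ℝ, IsBox ρ →
        |Dbox d w α γ ρ N| ≤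
          C * (max 1 (Real.log N)) ^ (d - 1) *
            max 1 (Real.log (max 1 (Real.log N))) := by
  obtain ⟨K, hK, hdisc⟩ := disc_bound d w hw
  obtain ⟨α, c, hc0, hc1, hbad⟩ := bad_exists d (by omega)
  refine ⟨α, K * 20 ^ (d + 1) / c, by positivity, ?_⟩
  intro N hN γ ρ hρ
  have hN1 : (1 : ℝ) ≤ N := by exact_mod_cast hN
  have hbadN := hbad N hN
  set Lg : ℝ := max 1 (Real.log N) with hLg
  set LL : ℝ := max 1 (Real.log Lg) with hLL
  have hLg1 : 1 ≤ Lg := le_max_left _ _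
  have hLL1 : 1 ≤ LL := le_max_left _ _
  have hφ1 : 1 ≤ Lg ^ (d - 1) * LL := one_le_mul_of_one_le_of_one_le (one_le_pow₀ hLg1) hLL1
  have hφ0 : 0 < Lg ^ (d - 1) * LL := by positivity
  have hNpos : (0 : ℝ) < N := by linarith
  have hTp0 : 0 < c * N / (Lg ^ (d - 1) * LL) := by positivity
  have hTpN : c * N / (Lg ^ (d - 1) * LL) ≤ N := by
    rw [div_le_iff₀ hφ0]
    nlinarith
  have hM : ∀ i, 1 ≤ (fun i => 1 / ρ i) i := by
    intro i
    have := hρ i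
    show 1 ≤ 1 / ρ i
    rw [le_div_iff₀ this.1]
    linarith
  have hlat := lattice_sum d α N hN1 (c * N / (Lg ^ (d - 1) * LL)) hTp0 hTpN (by
    intro m hm hmN n
    refine le_trans (le_of_eq ?_) (hbadN m hm hmN n)
    have hP1 : 0 < ∏ i, max 1 |(m i : ℝ)| :=
      Finset.prod_pos (fun i _ => lt_of_lt_of_le one_pos (le_max_left _ _))
    field_simp) (fun i => 1 / ρ i) hM
  have h := hdisc α γ ρ N _ (fun i => (hρ i).1) hN1 hlat
  refine h.trans (le_of_eq ?_)
  have hprod : (∏ i, ρ i) * (∏ i, 1 / ρ i) = 1 := by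
    rw [← Finset.prod_mul_distrib]
    exact Finset.prod_eq_one (fun i _ => mul_one_div_cancel (hρ i).1.ne')
  calc K * ((∏ i, ρ i) * N * (20 ^ (d + 1) * ((∏ i, 1 / ρ i) / (c * N / (Lg ^ (d - 1) * LL)))))
      = ((∏ i, ρ i) * (∏ i, 1 / ρ i)) *
        (K * 20 ^ (d + 1) * (N / (c * N / (Lg ^ (d - 1) * LL)))) := by ring
    _ = K * 20 ^ (d + 1) / c * Lg ^ (d - 1) * LL := by
        rw [hprod, one_mul]
        field_simp
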